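/- arXiv:1509.05364 — 2 statements merged into one kernel-verified Lean document; each statement's English description precedes it below -/
import Mathlib

section
/- Let n, m ∈ ℕ with m ≥ 2, and let u and v be accessible generalized words over a finite alphabet Σ with u ≡_{m,n}^X v. Then u·X_a^L ≡_{m,n-1}^X v·X_a^L for every letter a ∈ alph(u) = alph(v). -/
open scoped Classical

/-! ## Generalized words -/

structure GWord (A : Type) : Type 1 where
  P : Type
  ord : LinearOrder P
  w : P → A

namespace GWord

variable {A : Type}

instance (u : GWord A) : LinearOrder u.P := u.ord

/-- The set of letters occurring in a generalized word. -/
def alph (u : GWord A) : Set A := Set.range u.w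

/-- Restriction of a generalized word to a set of positions. -/
def restrict (u : GWord A) (s : Set u.P) : GWord A :=
  ⟨{ p // p ∈ s }, inferInstance, fun p => u.w p.1⟩

/-- `p` is the first `a`-labelled position of `u`. -/
def IsFirst (u : GWord A) (a : A) (p : u.P) : Prop :=
  u.w p = a ∧ ∀ q : u.P, u.w q = a → p ≤ q

/-- `p` is the last `a`-labelled position of `u`. -/
def IsLast (u : GWord A) (a : A) (p : u.P) : Prop :=
  u.w p = a ∧ ∀ q : u.P, u.w q = a → q ≤ p

/-- The factor strictly before the first occurrence of `a`. -/
noncomputable def XL (u : GWord A) (a : A) : GWord A :=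
  if h : ∃ p, u.IsFirst a p then u.restrict {q | q < h.choose} else u

/-- The factor strictly after the first occurrence of `a`. -/
noncomputable def XR (u : GWord A) (a : A) : GWord A :=
  if h : ∃ p, u.IsFirst a p then u.restrict {q | h.choose < q} else u

/-- The factor strictly before the last occurrence of `a`. -/
noncomputable def YL (u : GWord A) (a : A) : GWord A :=
  if h : ∃ p, u.IsLast a p then u.restrict {q | q < h.choose} else u

/-- The factor strictly after the last occurrence of `a`. -/
noncomputable def YR (u : GWord A) (a : A) : GWord A :=
  if h : ∃ p, u.IsLast a p then u.restrict {q | h.choose < q} else u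

/-- `C_{a,b}` is defined iff the first `a` is strictly to the right of the last `b`. -/
def CDefined (u : GWord A) (a b : A) : Prop :=
  ∃ p q, u.IsFirst a p ∧ u.IsLast b q ∧ q < p

/-- The factor strictly between the last `b` and the first `a` (junk value if undefined). -/
noncomputable def Cab (u : GWord A) (a b : A) : GWord A :=
  if h : u.CDefined a b then
    u.restrict {r | h.choose_spec.choose < r ∧ r < h.choose}
  else u

/-- Accessibility: first/last occurrences of letters after/before every position exist. -/
def Accessible (u : GWord A) : Prop :=
  (∀ a : A, (∃ p, u.w p = a) → ∃ p, u.IsFirst a p) ∧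
  (∀ a : A, (∃ p, u.w p = a) → ∃ p, u.IsLast a p) ∧
  (∀ (p : u.P) (a : A), (∃ q, p < q ∧ u.w q = a) →
    ∃ q, p < q ∧ u.w q = a ∧ ∀ r, p < r → u.w r = a → q ≤ r) ∧
  (∀ (p : u.P) (a : A), (∃ q, q < p ∧ u.w q = a) →
    ∃ q, q < p ∧ u.w q = a ∧ ∀ r, r < p → u.w r = a → r ≤ q)

/-- Concatenation of generalized words. -/
def append (u v : GWord A) : GWord A :=
  ⟨u.P ⊕ₗ v.P, inferInstance, fun x => Sum.elim u.w v.w (ofLex x)⟩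

/-- The power of a generalized word by an arbitrary linear order type `ν`
(positions ordered with the exponent component dominant). -/
def gpow (u : GWord A) (ν : Type) [LinearOrder ν] : GWord A :=
  ⟨ν ×ₗ u.P, inferInstance, fun x => u.w (ofLex x).2⟩

/-- A finite word as a generalized word. -/
def ofList (l : List A) : GWord A :=
  ⟨Fin l.length, inferInstance, fun i => l.get i⟩

end GWord

/-- The order type `ω + ω*`: a copy of `ℕ` followed by a reversed copy of `ℕ`. -/
abbrev OO : Type := ℕ ⊕ₗ ℕᵒᵈ

/-! ## The relations `≡_{m,n}^Z` -/

inductive ZK : Type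
  | X | Y | WI

inductive ZKind : Type
  | X | Y | XY | WI

/-- The relations `≡_{m,n}^X`, `≡_{m,n}^Y`, `≡_{m,n}^{WI}` (first argument is `n`). -/
def eqvAux {A : Type} : ℕ → ZK → ℕ → GWord A → GWord A → Prop
  | 0, _, _, _, _ => True
  | _ + 1, _, 0, _, _ => True
  | n + 1, ZK.X, m + 1, u, v =>
      u.alph = v.alph ∧ eqvAux n ZK.Y m u v ∧
      ∀ a ∈ u.alph, eqvAux n ZK.Y m (u.XL a) (v.XL a) ∧
        eqvAux n ZK.X (m + 1) (u.XR a) (v.XR a)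
  | n + 1, ZK.Y, m + 1, u, v =>
      u.alph = v.alph ∧ eqvAux n ZK.X m u v ∧
      ∀ a ∈ u.alph, eqvAux n ZK.Y (m + 1) (u.YL a) (v.YL a) ∧
        eqvAux n ZK.X m (u.YR a) (v.YR a)
  | n + 1, ZK.WI, m + 1, u, v =>
      u.alph = v.alph ∧
      (∀ a ∈ u.alph,
        eqvAux n ZK.WI m (u.XL a) (v.XL a) ∧ eqvAux n ZK.WI (m + 1) (u.XR a) (v.XR a) ∧
        eqvAux n ZK.WI (m + 1) (u.YL a) (v.YL a) ∧ eqvAux n ZK.WI m (u.YR a) (v.YR a)) ∧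
      ∀ a ∈ u.alph, ∀ b ∈ u.alph,
        (u.CDefined a b ↔ v.CDefined a b) ∧
        (u.CDefined a b → v.CDefined a b → eqvAux n ZK.WI m (u.Cab a b) (v.Cab a b))

/-- `wEquiv Z m n u v` is `u ≡_{m,n}^Z v`. -/
def wEquiv {A : Type} (Z : ZKind) (m n : ℕ) (u v : GWord A) : Prop :=
  match Z with
  | ZKind.X => eqvAux n ZK.X m u v
  | ZKind.Y => eqvAux n ZK.Y m u v
  | ZKind.XY => eqvAux n ZK.X m u v ∧ eqvAux n ZK.Y m u v
  | ZKind.WI => eqvAux n ZK.WI m u v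

/-! ## π-terms -/

inductive PiTerm (A : Type) : Type
  | eps : PiTerm A
  | letter : A → PiTerm A
  | mul : PiTerm A → PiTerm A → PiTerm A
  | pi : PiTerm A → PiTerm A

def listNPow {A : Type} (l : List A) : ℕ → List A
  | 0 => []
  | k + 1 => l ++ listNPow l k

/-- `[γ]_k`: substitute the natural number `k` for the formal power `π`. -/
def PiTerm.substNat {A : Type} : PiTerm A → ℕ → List A
  | .eps, _ => []
  | .letter a, _ => [a]
  | .mul α β, k => α.substNat k ++ β.substNat k
  | .pi γ, k => listNPow (γ.substNat k) k

/-- `[γ]_{ω+ω*}`: substitute the order type `ω + ω*` for the formal power `π`. -/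
def PiTerm.substOO {A : Type} : PiTerm A → GWord A
  | .eps => GWord.ofList []
  | .letter a => GWord.ofList [a]
  | .mul α β => α.substOO.append β.substOO
  | .pi γ => γ.substOO.gpow OO

/-! ## Finite monoids, equations, the Trotter–Weil hierarchy -/

/-- `M!`: the exponent of a finite monoid, the least `n ≥ 1` such that all `x^n` are
idempotent. -/
noncomputable def monoidExp (M : Type) [Monoid M] : ℕ :=
  sInf {n : ℕ | 1 ≤ n ∧ ∀ x : M, IsIdempotentElem (x ^ n)}

/-- The equation `α = β` of π-terms holds in the finite monoid `M`. -/
def EqHoldsIn {A : Type} (α β : PiTerm A) (M : Type) [Monoid M] : Prop :=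
  ∀ σ : FreeMonoid A →* M,
    σ (FreeMonoid.ofList (α.substNat (monoidExp M))) =
      σ (FreeMonoid.ofList (β.substNat (monoidExp M)))

/-- Green's relation `R`: `x R y` iff `xM = yM`. -/
def rGreen {M : Type} [Monoid M] (x y : M) : Prop :=
  Set.range (fun z => x * z) = Set.range (fun z => y * z)

/-- Green's relation `L`: `x L y` iff `Mx = My`. -/
def lGreen {M : Type} [Monoid M] (x y : M) : Prop :=
  Set.range (fun z => z * x) = Set.range (fun z => z * y)

/-- `J`-triviality: `MxM = MyM` implies `x = y`. -/
def IsJTrivial (M : Type) [Monoid M] : Prop :=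
  ∀ x y : M, {z | ∃ a b, z = a * x * b} = {z | ∃ a b, z = a * y * b} → x = y

/-- The relation `∼_K`. -/
def simK {M : Type} [Monoid M] (x y : M) : Prop :=
  ∀ e : M, IsIdempotentElem e → (rGreen (e * x) e ∨ rGreen (e * y) e) → e * x = e * y

/-- The relation `∼_D`. -/
def simD {M : Type} [Monoid M] (x y : M) : Prop :=
  ∀ e : M, IsIdempotentElem e → (lGreen (x * e) e ∨ lGreen (y * e) e) → x * e = y * e

/-- `∼_K` as a congruence (it is a congruence, so `conGen` does not change it). -/
def KCon (M : Type) [Monoid M] : Con M := conGen simK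

/-- `∼_D` as a congruence. -/
def DCon (M : Type) [Monoid M] : Con M := conGen simD

/-- `InRLAux k true M _ = (M ∈ R_{k+1})` and `InRLAux k false M _ = (M ∈ L_{k+1})`. -/
def InRLAux : ℕ → Bool → (M : Type) → Monoid M → Prop
  | 0, _, M, i => letI := i; IsJTrivial M
  | k + 1, true, M, i => letI := i; InRLAux k false (KCon M).Quotient inferInstance
  | k + 1, false, M, i => letI := i; InRLAux k true (DCon M).Quotient inferInstance

/-- `M ∈ R_m` (for `m ≥ 1`). -/
def InRm (m : ℕ) (M : Type) [i : Monoid M] : Prop := InRLAux (m - 1) true M i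

/-- `M ∈ L_m` (for `m ≥ 1`). -/
def InLm (m : ℕ) (M : Type) [i : Monoid M] : Prop := InRLAux (m - 1) false M i

/-- `N` divides `M`: `N` is a homomorphic image of a submonoid of `M`. -/
def MDivides (N M : Type) [Monoid N] [Monoid M] : Prop :=
  ∃ (S : Submonoid M) (f : S →* N), Function.Surjective f

/-- `N ∈ R_m ∨ L_m`: `N` divides a direct product `M₁ × M₂` with `M₁ ∈ R_m`, `M₂ ∈ L_m`. -/
def InJoin (m : ℕ) (N : Type) [Monoid N] : Prop :=
  ∃ (M₁ M₂ : Type) (i₁ : Monoid M₁) (i₂ : Monoid M₂),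
    letI := i₁; letI := i₂;
    Finite M₁ ∧ Finite M₂ ∧ InRm m M₁ ∧ InLm m M₂ ∧ MDivides N (M₁ × M₂)

/-- `M ∈ DA`, via the equation `(xyz)^{M!} y (xyz)^{M!} = (xyz)^{M!}`. -/
def InDA (M : Type) [Monoid M] : Prop :=
  ∀ x y z : M,
    (x * y * z) ^ monoidExp M * y * (x * y * z) ^ monoidExp M = (x * y * z) ^ monoidExp M

/-! ## The π-terms `U_m`, `V_m` -/

inductive UVLetter : Type
  | s | t | x (i : ℕ) | y (i : ℕ)

/-- `U_m` (indexed from 1; `Uterm 0` is a junk value). -/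
def Uterm : ℕ → PiTerm UVLetter
  | 0 => PiTerm.eps
  | 1 =>
      PiTerm.mul
        (PiTerm.pi (PiTerm.mul (PiTerm.letter UVLetter.s) (PiTerm.letter (UVLetter.x 1))))
        (PiTerm.mul (PiTerm.letter UVLetter.s)
          (PiTerm.pi (PiTerm.mul (PiTerm.letter (UVLetter.y 1)) (PiTerm.letter UVLetter.t))))
  | m + 2 =>
      PiTerm.mul
        (PiTerm.pi (PiTerm.mul (Uterm (m + 1)) (PiTerm.letter (UVLetter.x (m + 2)))))
        (PiTerm.mul (Uterm (m + 1))
          (PiTerm.pi (PiTerm.mul (PiTerm.letter (UVLetter.y (m + 2))) (Uterm (m + 1)))))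

/-- `V_m` (indexed from 1; `Vterm 0` is a junk value). -/
def Vterm : ℕ → PiTerm UVLetter
  | 0 => PiTerm.eps
  | 1 =>
      PiTerm.mul
        (PiTerm.pi (PiTerm.mul (PiTerm.letter UVLetter.s) (PiTerm.letter (UVLetter.x 1))))
        (PiTerm.mul (PiTerm.letter UVLetter.t)
          (PiTerm.pi (PiTerm.mul (PiTerm.letter (UVLetter.y 1)) (PiTerm.letter UVLetter.t))))
  | m + 2 =>
      PiTerm.mul
        (PiTerm.pi (PiTerm.mul (Uterm (m + 1)) (PiTerm.letter (UVLetter.x (m + 2)))))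
        (PiTerm.mul (Vterm (m + 1))
          (PiTerm.pi (PiTerm.mul (PiTerm.letter (UVLetter.y (m + 2))) (Uterm (m + 1)))))

/-- The relation `≡_{m,n}^Z` on the free monoid `Σ*`, as a congruence
(it is a congruence, so `conGen` does not change it). -/
def eqvCon (A : Type) (Z : ZKind) (m n : ℕ) : Con (FreeMonoid A) :=
  conGen (fun u v => wEquiv Z m n (GWord.ofList u.toList) (GWord.ofList v.toList))

namespace GWord

variable {A : Type}

/-- Isomorphism of generalized words: a label-preserving order isomorphism of positions. -/
def Iso (u v : GWord A) : Prop :=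
  ∃ e : u.P ≃o v.P, ∀ p, v.w (e p) = u.w p

theorem Iso.symm {u v : GWord A} : u.Iso v → v.Iso u := by
  rintro ⟨e, he⟩
  exact ⟨e.symm, fun p => by simpa using (he (e.symm p)).symm⟩

theorem Iso.trans {u v x : GWord A} : u.Iso v → v.Iso x → u.Iso x := by
  rintro ⟨e, he⟩ ⟨f, hf⟩
  exact ⟨e.trans f, fun p => (hf (e p)).trans (he p)⟩

theorem Iso.alph_eq {u v : GWord A} : u.Iso v → u.alph = v.alph := by
  rintro ⟨e, he⟩
  ext a
  constructor
  · rintro ⟨p, rfl⟩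
    exact ⟨e p, he p⟩
  · rintro ⟨p, rfl⟩
    exact ⟨e.symm p, by simpa using (he (e.symm p)).symm⟩

theorem restrict_iso_restrict {u v : GWord A} (e : u.P ≃o v.P) (he : ∀ p, v.w (e p) = u.w p)
    {s : Set u.P} {t : Set v.P} (hst : ∀ p, p ∈ s ↔ e p ∈ t) :
    (u.restrict s).Iso (v.restrict t) :=
  ⟨⟨e.toEquiv.subtypeEquiv hst, fun {p q} => e.le_iff_le (x := p.1) (y := q.1)⟩,
    fun p => he p.1⟩

theorem restrict_restrict_iso (u : GWord A) {s r : Set u.P} {t : Set (u.restrict s).P}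
    (h : ∀ p, p ∈ r ↔ ∃ hp : p ∈ s, (⟨p, hp⟩ : (u.restrict s).P) ∈ t) :
    ((u.restrict s).restrict t).Iso (u.restrict r) :=
  ⟨⟨⟨fun p => ⟨p.1.1, (h _).2 ⟨p.1.2, p.2⟩⟩,
      fun p => ⟨⟨p.1, ((h _).1 p.2).1⟩, ((h _).1 p.2).2⟩,
      fun _ => rfl, fun _ => rfl⟩, Iff.rfl⟩, fun _ => rfl⟩

theorem IsFirst.unique {u : GWord A} {a : A} {p q : u.P} (hp : u.IsFirst a p)
    (hq : u.IsFirst a q) : p = q :=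
  le_antisymm (hp.2 q hq.1) (hq.2 p hp.1)

theorem IsLast.unique {u : GWord A} {a : A} {p q : u.P} (hp : u.IsLast a p)
    (hq : u.IsLast a q) : p = q :=
  le_antisymm (hq.2 p hp.1) (hp.2 q hq.1)

theorem IsFirst.XL_eq {u : GWord A} {a : A} {p : u.P} (hp : u.IsFirst a p) :
    u.XL a = u.restrict {q | q < p} := by
  have h : ∃ p, u.IsFirst a p := ⟨p, hp⟩
  rw [XL, dif_pos h, h.choose_spec.unique hp]

theorem IsFirst.XR_eq {u : GWord A} {a : A} {p : u.P} (hp : u.IsFirst a p) :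
    u.XR a = u.restrict {q | p < q} := by
  have h : ∃ p, u.IsFirst a p := ⟨p, hp⟩
  rw [XR, dif_pos h, h.choose_spec.unique hp]

theorem IsLast.YL_eq {u : GWord A} {a : A} {p : u.P} (hp : u.IsLast a p) :
    u.YL a = u.restrict {q | q < p} := by
  have h : ∃ p, u.IsLast a p := ⟨p, hp⟩
  rw [YL, dif_pos h, h.choose_spec.unique hp]

theorem IsLast.YR_eq {u : GWord A} {a : A} {p : u.P} (hp : u.IsLast a p) :
    u.YR a = u.restrict {q | p < q} := by
  have h : ∃ p, u.IsLast a p := ⟨p, hp⟩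
  rw [YR, dif_pos h, h.choose_spec.unique hp]

theorem IsFirst.map {u v : GWord A} (e : u.P ≃o v.P) (he : ∀ p, v.w (e p) = u.w p) {a : A}
    {p : u.P} (hp : u.IsFirst a p) : v.IsFirst a (e p) := by
  refine ⟨(he p).trans hp.1, fun q hq => ?_⟩
  rw [← e.le_symm_apply]
  exact hp.2 _ (by rw [← he, e.apply_symm_apply, hq])

theorem IsLast.map {u v : GWord A} (e : u.P ≃o v.P) (he : ∀ p, v.w (e p) = u.w p) {a : A}
    {p : u.P} (hp : u.IsLast a p) : v.IsLast a (e p) := by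
  refine ⟨(he p).trans hp.1, fun q hq => ?_⟩
  rw [← e.symm_apply_le]
  exact hp.2 _ (by rw [← he, e.apply_symm_apply, hq])

theorem Iso.exists_isFirst {u v : GWord A} {a : A} :
    u.Iso v → (∃ p, u.IsFirst a p) → ∃ p, v.IsFirst a p := by
  rintro ⟨e, he⟩ ⟨p, hp⟩
  exact ⟨e p, hp.map e he⟩

theorem Iso.exists_isLast {u v : GWord A} {a : A} :
    u.Iso v → (∃ p, u.IsLast a p) → ∃ p, v.IsLast a p := by
  rintro ⟨e, he⟩ ⟨p, hp⟩
  exact ⟨e p, hp.map e he⟩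

theorem Iso.XL_XR {u v : GWord A} (h : u.Iso v) (a : A) :
    (u.XL a).Iso (v.XL a) ∧ (u.XR a).Iso (v.XR a) := by
  by_cases hu : ∃ p, u.IsFirst a p
  · obtain ⟨p, hp⟩ := hu
    obtain ⟨e, he⟩ := h
    rw [hp.XL_eq, (hp.map e he).XL_eq, hp.XR_eq, (hp.map e he).XR_eq]
    exact ⟨restrict_iso_restrict e he fun q => (e.lt_iff_lt).symm,
      restrict_iso_restrict e he fun q => (e.lt_iff_lt).symm⟩
  · have hv : ¬ ∃ p, v.IsFirst a p := fun hv => hu (h.symm.exists_isFirst hv)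
    rw [XL, XL, XR, XR, dif_neg hu, dif_neg hv, dif_neg hu, dif_neg hv]
    exact ⟨h, h⟩

theorem Iso.YL_YR {u v : GWord A} (h : u.Iso v) (a : A) :
    (u.YL a).Iso (v.YL a) ∧ (u.YR a).Iso (v.YR a) := by
  by_cases hu : ∃ p, u.IsLast a p
  · obtain ⟨p, hp⟩ := hu
    obtain ⟨e, he⟩ := h
    rw [hp.YL_eq, (hp.map e he).YL_eq, hp.YR_eq, (hp.map e he).YR_eq]
    exact ⟨restrict_iso_restrict e he fun q => (e.lt_iff_lt).symm,
      restrict_iso_restrict e he fun q => (e.lt_iff_lt).symm⟩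
  · have hv : ¬ ∃ p, v.IsLast a p := fun hv => hu (h.symm.exists_isLast hv)
    rw [YL, YL, YR, YR, dif_neg hu, dif_neg hv, dif_neg hu, dif_neg hv]
    exact ⟨h, h⟩

/-- `≡_{m,n}^X` and `≡_{m,n}^Y` are invariant under isomorphism. -/
theorem eqvAux_X_Y_congr (n : ℕ) : ∀ (m : ℕ) {u u' v v' : GWord A}, u.Iso u' → v.Iso v' →
    (eqvAux n ZK.X m u v → eqvAux n ZK.X m u' v') ∧
      (eqvAux n ZK.Y m u v → eqvAux n ZK.Y m u' v') := by
  induction n with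
  | zero => intro m u u' v v' _ _; simp [eqvAux]
  | succ n ih =>
    rintro (_ | m) u u' v v' hu hv
    · simp [eqvAux]
    · simp only [eqvAux, ← hu.alph_eq, ← hv.alph_eq]
      refine ⟨fun ⟨h₁, h₂, h₃⟩ => ⟨h₁, (ih m hu hv).2 h₂, fun a ha => ?_⟩,
        fun ⟨h₁, h₂, h₃⟩ => ⟨h₁, (ih m hu hv).1 h₂, fun a ha => ?_⟩⟩
      · exact ⟨(ih _ (hu.XL_XR a).1 (hv.XL_XR a).1).2 (h₃ a ha).1,
          (ih _ (hu.XL_XR a).2 (hv.XL_XR a).2).1 (h₃ a ha).2⟩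
      · exact ⟨(ih _ (hu.YL_YR a).1 (hv.YL_YR a).1).2 (h₃ a ha).1,
          (ih _ (hu.YL_YR a).2 (hv.YL_YR a).2).1 (h₃ a ha).2⟩

/-- `≡_{m,n+1}^X` refines `≡_{m,n}^X`, and likewise for `≡^Y`. -/
theorem eqvAux_X_Y_of_succ (n : ℕ) : ∀ (m : ℕ) {u v : GWord A},
    (eqvAux (n + 1) ZK.X m u v → eqvAux n ZK.X m u v) ∧
      (eqvAux (n + 1) ZK.Y m u v → eqvAux n ZK.Y m u v) := by
  induction n with
  | zero => intro m u v; simp [eqvAux]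
  | succ n ih =>
    rintro (_ | m) u v
    · simp [eqvAux]
    · rw [eqvAux, eqvAux, eqvAux, eqvAux]
      exact ⟨fun ⟨h₁, h₂, h₃⟩ => ⟨h₁, (ih m).2 h₂, fun a ha =>
          ⟨(ih _).2 (h₃ a ha).1, (ih _).1 (h₃ a ha).2⟩⟩,
        fun ⟨h₁, h₂, h₃⟩ => ⟨h₁, (ih m).1 h₂, fun a ha =>
          ⟨(ih _).2 (h₃ a ha).1, (ih _).1 (h₃ a ha).2⟩⟩⟩

/-- The half of accessibility that concerns first occurrences. -/
def FirstAccessible (u : GWord A) : Prop :=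
  (∀ a ∈ u.alph, ∃ p, u.IsFirst a p) ∧
  ∀ (p : u.P) (a : A), (∃ q, p < q ∧ u.w q = a) →
    ∃ q, p < q ∧ u.w q = a ∧ ∀ r, p < r → u.w r = a → q ≤ r

theorem Accessible.firstAccessible {u : GWord A} (h : u.Accessible) : u.FirstAccessible :=
  ⟨h.1, h.2.2.1⟩

theorem FirstAccessible.XR {u : GWord A} (h : u.FirstAccessible) (b : A) :
    (u.XR b).FirstAccessible := by
  by_cases hb : ∃ p, u.IsFirst b p
  · obtain ⟨p, hp⟩ := hb
    rw [hp.XR_eq]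
    constructor
    · rintro a ⟨⟨q, hq⟩, rfl⟩
      obtain ⟨r, hr, hra, hmin⟩ := h.2 p _ ⟨q, hq, rfl⟩
      exact ⟨⟨r, hr⟩, hra, fun x hx => hmin x.1 x.2 hx⟩
    · rintro ⟨q, hq⟩ a ⟨⟨r, hr⟩, hqr, hra⟩
      obtain ⟨x, hx, hxa, hmin⟩ := h.2 q a ⟨r, hqr, hra⟩
      exact ⟨⟨x, lt_trans (show p < q from hq) hx⟩, hx, hxa, fun y hy hya => hmin y.1 hy hya⟩
  · rwa [GWord.XR, dif_neg hb]

theorem FirstAccessible.exists_isFirst_lt {u : GWord A} (h : u.FirstAccessible) {a b : A}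
    (ha : a ∈ u.alph) (hb : b ∈ (u.XL a).alph) :
    ∃ p q, u.IsFirst a p ∧ u.IsFirst b q ∧ q < p := by
  obtain ⟨p, hp⟩ := h.1 a ha
  rw [hp.XL_eq] at hb
  obtain ⟨⟨r, hr⟩, hrb⟩ := hb
  obtain ⟨q, hq⟩ := h.1 b ⟨r, hrb⟩
  exact ⟨p, q, hp, hq, lt_of_le_of_lt (hq.2 r hrb) hr⟩

theorem mem_alph_XR {u : GWord A} {a b : A} {p q : u.P} (hp : u.IsFirst a p)
    (hq : u.IsFirst b q) (h : q < p) : a ∈ (u.XR b).alph := by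
  rw [hq.XR_eq]
  exact ⟨⟨p, h⟩, hp.1⟩

theorem XL_XL_iso {u : GWord A} {a b : A} {p q : u.P} (hp : u.IsFirst a p)
    (hq : u.IsFirst b q) (h : q < p) : ((u.XL a).XL b).Iso (u.XL b) := by
  have hq' : (u.restrict {r | r < p}).IsFirst b ⟨q, h⟩ := ⟨hq.1, fun r hr => hq.2 r.1 hr⟩
  rw [hp.XL_eq, hq.XL_eq, hq'.XL_eq]
  exact restrict_restrict_iso u fun r => ⟨fun hr => ⟨lt_trans (show r < q from hr) h, hr⟩,
    fun ⟨_, hr⟩ => hr⟩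

theorem XL_XR_iso {u : GWord A} {a b : A} {p q : u.P} (hp : u.IsFirst a p)
    (hq : u.IsFirst b q) (h : q < p) : ((u.XL a).XR b).Iso ((u.XR b).XL a) := by
  have hq' : (u.restrict {r | r < p}).IsFirst b ⟨q, h⟩ := ⟨hq.1, fun r hr => hq.2 r.1 hr⟩
  have hp' : (u.restrict {r | q < r}).IsFirst a ⟨p, h⟩ := ⟨hp.1, fun r hr => hp.2 r.1 hr⟩
  rw [hp.XL_eq, hq.XR_eq, hq'.XR_eq, hp'.XL_eq]
  refine Iso.trans (v := u.restrict {r | q < r ∧ r < p}) ?_ (Iso.symm ?_)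
  · exact restrict_restrict_iso u fun r => ⟨fun hr => ⟨hr.2, hr.1⟩, fun ⟨h₁, h₂⟩ => ⟨h₂, h₁⟩⟩
  · exact restrict_restrict_iso u fun r => ⟨fun hr => ⟨hr.1, hr.2⟩, fun ⟨h₁, h₂⟩ => ⟨h₁, h₂⟩⟩

theorem FirstAccessible.eqvAux_XL (m n : ℕ) : ∀ {u v : GWord A}, u.FirstAccessible →
    v.FirstAccessible → eqvAux (n + 1) ZK.X (m + 2) u v →
    ∀ a ∈ u.alph, eqvAux n ZK.X (m + 2) (u.XL a) (v.XL a) := by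
  induction n with
  | zero => intros; simp [eqvAux]
  | succ n ih =>
    intro u v hu hv h a ha
    rw [eqvAux] at h
    obtain ⟨halph, -, hstep⟩ := h
    have hY := (hstep a ha).1
    have halph' : (u.XL a).alph = (v.XL a).alph := by
      rw [eqvAux] at hY
      exact hY.1
    rw [eqvAux]
    refine ⟨halph', (eqvAux_X_Y_of_succ n _).2 hY, fun b hb => ?_⟩
    obtain ⟨p, q, hp, hq, hqp⟩ := hu.exists_isFirst_lt ha hb
    obtain ⟨p', q', hp', hq', hqp'⟩ := hv.exists_isFirst_lt (halph ▸ ha) (halph' ▸ hb)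
    have hbu := hstep b ⟨q, hq.1⟩
    exact ⟨(eqvAux_X_Y_congr n _ (XL_XL_iso hp hq hqp).symm (XL_XL_iso hp' hq' hqp').symm).2
        ((eqvAux_X_Y_of_succ n _).2 hbu.1),
      (eqvAux_X_Y_congr n _ (XL_XR_iso hp hq hqp).symm (XL_XR_iso hp' hq' hqp').symm).1
        (ih (hu.XR b) (hv.XR b) hbu.2 a (mem_alph_XR hp hq hqp))⟩

end GWord

/-- Lemma: for `m ≥ 2`, an `X_a^L` factorization only costs one step, not a direction. -/
theorem XL_step_for_m_ge_two (A : Type) [Fintype A] (n m : ℕ) (hn : 1 ≤ n) (hm : 2 ≤ m)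
    (u v : GWord A) (hu : u.Accessible) (hv : v.Accessible)
    (h : wEquiv ZKind.X m n u v) :
    ∀ a ∈ u.alph, wEquiv ZKind.X m (n - 1) (u.XL a) (v.XL a) := by
  obtain ⟨n, rfl⟩ := Nat.exists_eq_add_of_le' hn
  obtain ⟨m, rfl⟩ := Nat.exists_eq_add_of_le' hm
  exact hu.firstAccessible.eqvAux_XL m n hv.firstAccessible h
end

section
/- Let M be a finite monoid, φ : Σ* → M a monoid homomorphism from the free monoid over a finite alphabet Σ, m ∈ ℕ_0, and let m_u, m_v ∈ M. Suppose (u_n, v_n)_{n ∈ ℕ_0} is an infinite sequence of pairs of finite words u_n, v_n ∈ Σ* such that for every n ∈ ℕ_0: u_n ≡_{m,n}^X v_n, φ(u_n) = m_u, and φ(v_n) = m_v. Then there exist π-terms α and β over Σ such that φ([α]_{M!}) = m_u, φ([β]_{M!}) = m_v, and [α]_{ω+ω*} ≡_m^X [β]_{ω+ω*}. -/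
open scoped Classical

/-! ## Lists: factors at first and last occurrences -/

namespace WordFactor

variable {A : Type}

/-- The prefix of a list strictly before the first occurrence of `a`. -/
noncomputable def xl (a : A) : List A → List A
  | [] => []
  | b :: l => if b = a then [] else b :: xl a l

/-- The suffix of a list strictly after the first occurrence of `a`. -/
noncomputable def xr (a : A) : List A → List A
  | [] => []
  | b :: l => if b = a then l else xr a l

/-- The prefix of a list strictly before the last occurrence of `a`. -/
noncomputable def yl (a : A) (l : List A) : List A := (xr a l.reverse).reverse

/-- The suffix of a list strictly after the last occurrence of `a`. -/
noncomputable def yr (a : A) (l : List A) : List A := (xl a l.reverse).reverse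

theorem xl_append_of_mem {a : A} {u : List A} (h : a ∈ u) (v : List A) :
    xl a (u ++ v) = xl a u := by
  induction u with
  | nil => simp at h
  | cons b u ih => simp only [List.cons_append, xl]; grind

theorem xl_append_of_not_mem {a : A} {u : List A} (h : a ∉ u) (v : List A) :
    xl a (u ++ v) = u ++ xl a v := by
  induction u with
  | nil => rfl
  | cons b u ih => simp only [List.cons_append, xl]; grind

theorem xr_append_of_mem {a : A} {u : List A} (h : a ∈ u) (v : List A) :
    xr a (u ++ v) = xr a u ++ v := by
  induction u with
  | nil => simp at h
  | cons b u ih => simp only [List.cons_append, xr]; grind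

theorem xr_append_of_not_mem {a : A} {u : List A} (h : a ∉ u) (v : List A) :
    xr a (u ++ v) = xr a v := by
  induction u with
  | nil => rfl
  | cons b u ih => simp only [List.cons_append, xr]; grind

theorem yl_append_of_mem {a : A} {v : List A} (u : List A) (h : a ∈ v) :
    yl a (u ++ v) = u ++ yl a v := by
  simp [yl, xr_append_of_mem (List.mem_reverse.2 h)]

theorem yl_append_of_not_mem {a : A} {v : List A} (u : List A) (h : a ∉ v) :
    yl a (u ++ v) = yl a u := by
  simp [yl, xr_append_of_not_mem (mt List.mem_reverse.1 h)]

theorem yr_append_of_mem {a : A} {v : List A} (u : List A) (h : a ∈ v) :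
    yr a (u ++ v) = yr a v := by
  simp [yr, xl_append_of_mem (List.mem_reverse.2 h)]

theorem yr_append_of_not_mem {a : A} {v : List A} (u : List A) (h : a ∉ v) :
    yr a (u ++ v) = yr a u ++ v := by
  simp [yr, xl_append_of_not_mem (mt List.mem_reverse.1 h)]

theorem xl_append_cons_xr {a : A} {u : List A} (h : a ∈ u) : xl a u ++ a :: xr a u = u := by
  induction u with
  | nil => simp at h
  | cons b u ih => simp only [xl, xr]; grind

theorem not_mem_xl (a : A) (u : List A) : a ∉ xl a u := by
  induction u with
  | nil => simp [xl]
  | cons b u ih => simp only [xl]; grind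

theorem xl_subset (a : A) (u : List A) : xl a u ⊆ u := by
  induction u with
  | nil => simp [xl]
  | cons b u ih => simp only [xl]; grind

theorem xr_subset (a : A) (u : List A) : xr a u ⊆ u := by
  induction u with
  | nil => simp [xr]
  | cons b u ih => simp only [xr]; grind

theorem xl_xl {a b : A} {u : List A} (h : b ∈ xl a u) : xl b (xl a u) = xl b u := by
  induction u with
  | nil => rfl
  | cons c u ih =>
    by_cases hc : c = a
    · simp [xl, hc] at h
    · by_cases hb : c = b <;> simp_all [xl]
      grind

theorem xr_xl {a b : A} {u : List A} (h : b ∈ xl a u) : xr b (xl a u) = xl a (xr b u) := by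
  induction u with
  | nil => rfl
  | cons c u ih =>
    by_cases hc : c = a
    · simp [xl, hc] at h
    · by_cases hb : c = b <;> simp_all [xl, xr]
      grind

theorem mem_xr_of_mem_xl {a b : A} {u : List A} (ha : a ∈ u) (h : b ∈ xl a u) :
    a ∈ xr b u := by
  induction u with
  | nil => simp at ha
  | cons c u ih =>
    simp only [xl, xr] at *
    grind

/-- A nonempty word factors as `p a q` where `a` is the letter whose first occurrence comes
last. -/
theorem exists_first_arch {u : List A} (h : u ≠ []) :
    ∃ a ∈ u, ∀ b ∈ u, b = a ∨ b ∈ xl a u := by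
  induction u using List.reverseRecOn with
  | nil => exact absurd rfl h
  | append_singleton u c ih =>
    by_cases hc : c ∈ u
    · obtain ⟨a, ha, hau⟩ := ih (List.ne_nil_of_mem hc)
      refine ⟨a, by simp [ha], fun b hb => ?_⟩
      rw [xl_append_of_mem ha]
      grind
    · refine ⟨c, by simp, fun b hb => ?_⟩
      rw [xl_append_of_not_mem hc]
      grind

theorem mem_listNPow {l : List A} {k : ℕ} {a : A} (h : a ∈ listNPow l k) : a ∈ l := by
  induction k with
  | zero => simp [listNPow] at h
  | succ k ih => simp only [listNPow, List.mem_append] at h; tauto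

theorem listNPow_succ' (l : List A) (k : ℕ) : listNPow l (k + 1) = listNPow l k ++ l := by
  induction k with
  | zero => simp [listNPow]
  | succ k ih =>
    simp only [listNPow, List.append_assoc] at ih ⊢
    rw [ih]

/-! ## The relations `≡_{m,n}^X` on finite words -/

/-- The relation `≡_{m,n}^X` on finite words; `≡_{m,n}^Y` is this relation on reversed words. -/
def XEquiv : ℕ → ℕ → List A → List A → Prop
  | 0, _, _, _ => True
  | _ + 1, 0, _, _ => True
  | n + 1, m + 1, u, v =>
      (∀ a, a ∈ u ↔ a ∈ v) ∧ XEquiv n m u.reverse v.reverse ∧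
      ∀ a ∈ u, XEquiv n m (xl a u).reverse (xl a v).reverse ∧
        XEquiv n (m + 1) (xr a u) (xr a v)

namespace XEquiv

@[simp] theorem zero_right (n : ℕ) (u v : List A) : XEquiv n 0 u v := by
  cases n <;> simp [XEquiv]

@[refl] theorem refl (n m : ℕ) (u : List A) : XEquiv n m u u := by
  induction n generalizing m u with
  | zero => trivial
  | succ n ih =>
    cases m with
    | zero => trivial
    | succ m => exact ⟨fun _ => Iff.rfl, ih _ _, fun a _ => ⟨ih _ _, ih _ _⟩⟩

theorem symm {n m : ℕ} {u v : List A} (h : XEquiv n m u v) : XEquiv n m v u := by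
  induction n generalizing m u v with
  | zero => trivial
  | succ n ih =>
    cases m with
    | zero => trivial
    | succ m =>
      obtain ⟨h1, h2, h3⟩ := h
      exact ⟨fun a => (h1 a).symm, ih h2, fun a ha =>
        ⟨ih (h3 a ((h1 a).2 ha)).1, ih (h3 a ((h1 a).2 ha)).2⟩⟩

theorem trans {n m : ℕ} {u v w : List A} (h : XEquiv n m u v) (h' : XEquiv n m v w) :
    XEquiv n m u w := by
  induction n generalizing m u v w with
  | zero => trivial
  | succ n ih =>
    cases m with
    | zero => trivial
    | succ m =>
      obtain ⟨h1, h2, h3⟩ := h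
      obtain ⟨h1', h2', h3'⟩ := h'
      exact ⟨fun a => (h1 a).trans (h1' a), ih h2 h2', fun a ha =>
        ⟨ih (h3 a ha).1 (h3' a ((h1 a).1 ha)).1, ih (h3 a ha).2 (h3' a ((h1 a).1 ha)).2⟩⟩

theorem of_succ {n m : ℕ} {u v : List A} (h : XEquiv (n + 1) m u v) : XEquiv n m u v := by
  induction n generalizing m u v with
  | zero => trivial
  | succ n ih =>
    cases m with
    | zero => trivial
    | succ m =>
      obtain ⟨h1, h2, h3⟩ := h
      exact ⟨h1, ih h2, fun a ha => ⟨ih (h3 a ha).1, ih (h3 a ha).2⟩⟩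

theorem mono {n n' m : ℕ} (hn : n ≤ n') {u v : List A} (h : XEquiv n' m u v) :
    XEquiv n m u v := by
  induction hn with
  | refl => exact h
  | step _ ih => exact ih h.of_succ

theorem mem_iff {n m : ℕ} {u v : List A} (h : XEquiv (n + 1) (m + 1) u v) (a : A) :
    a ∈ u ↔ a ∈ v := h.1 a

theorem append {n m : ℕ} {u u' v v' : List A} (hu : XEquiv n m u u') (hv : XEquiv n m v v') :
    XEquiv n m (u ++ v) (u' ++ v') := by
  induction n generalizing m u u' v v' with
  | zero => trivial
  | succ n ih =>
    cases m with
    | zero => trivial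
    | succ m =>
      obtain ⟨h1, h2, h3⟩ := hu
      have hv0 := hv.of_succ
      obtain ⟨k1, k2, k3⟩ := hv
      refine ⟨fun a => by simp [h1, k1], by simpa using ih k2 h2, fun a ha => ?_⟩
      by_cases hau : a ∈ u
      · have hau' := (h1 a).1 hau
        rw [xl_append_of_mem hau, xl_append_of_mem hau', xr_append_of_mem hau,
          xr_append_of_mem hau']
        exact ⟨(h3 a hau).1, ih (h3 a hau).2 hv0⟩
      · have hau' := mt (h1 a).2 hau
        have hav : a ∈ v := by simpa [hau] using ha
        rw [xl_append_of_not_mem hau, xl_append_of_not_mem hau', xr_append_of_not_mem hau,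
          xr_append_of_not_mem hau', List.reverse_append, List.reverse_append]
        exact ⟨ih (k3 a hav).1 h2, (k3 a hav).2⟩

theorem npow {n m : ℕ} {u v : List A} (h : XEquiv n m u v) (k : ℕ) :
    XEquiv n m (listNPow u k) (listNPow v k) := by
  induction k with
  | zero => rfl
  | succ k ih => exact h.append ih

/-- A high power `e ^ k` on the left makes the `X`-relation of level `m + 1` insensitive to
anything but the `Y`-relation of level `m`. -/
theorem npow_append {n m k : ℕ} (hk : n ≤ k) {e s t : List A} (hs : s ⊆ e) (ht : t ⊆ e)
    (h : XEquiv n m s.reverse t.reverse) :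
    XEquiv n (m + 1) (listNPow e k ++ s) (listNPow e k ++ t) := by
  induction n generalizing k with
  | zero => trivial
  | succ n ih =>
    obtain ⟨k, rfl⟩ : ∃ j, k = j + 1 := ⟨k - 1, by omega⟩
    have hmem : ∀ (w : List A) (a : A), w ⊆ e → a ∈ listNPow e (k + 1) ++ w → a ∈ e := by
      intro w a hw
      simp only [List.mem_append]
      rintro (h | h)
      exacts [mem_listNPow h, hw h]
    refine ⟨fun a => ⟨fun ha => ?_, fun ha => ?_⟩, ?_, fun a ha => ?_⟩
    · simp [listNPow, hmem s a hs ha]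
    · simp [listNPow, hmem t a ht ha]
    · rw [List.reverse_append, List.reverse_append]
      exact h.of_succ.append (refl _ _ _)
    · have hae := hmem s a hs ha
      simp only [listNPow, List.append_assoc, xl_append_of_mem hae, xr_append_of_mem hae]
      exact ⟨refl _ _ _, (refl _ _ _).append (ih (by omega) h.of_succ)⟩

theorem xl_right {n m : ℕ} {u v : List A} (h : XEquiv (n + 1) (m + 2) u v) {a : A}
    (ha : a ∈ u) : XEquiv n (m + 2) (xl a u) (xl a v) := by
  induction n generalizing u v with
  | zero => trivial
  | succ n ih =>
    have h0 := h
    obtain ⟨h1, h2, h3⟩ := h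
    have hrev := (h3 a ha).1
    have hmem : ∀ b, b ∈ xl a u ↔ b ∈ xl a v := fun b => by simpa using hrev.mem_iff b
    refine ⟨hmem, hrev.of_succ, fun b hb => ?_⟩
    have hb' := (hmem b).1 hb
    have hbu := xl_subset a u hb
    rw [xl_xl hb, xl_xl hb', xr_xl hb, xr_xl hb']
    exact ⟨(h3 b hbu).1.of_succ, ih (h3 b hbu).2 (mem_xr_of_mem_xl ha hb)⟩

end XEquiv

/-! ## Approximating generalized words by finite words -/

/-- `Approx u n s l`: up to `n` nested factorizations at first and last occurrences, the factor
of `u` on the positions in `s` looks like the finite word `l`. -/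
def Approx (u : GWord A) : ℕ → Set u.P → List A → Prop
  | 0, _, _ => True
  | n + 1, s, l =>
      (∀ a, a ∈ l ↔ ∃ p ∈ s, u.w p = a) ∧ Approx u n s l ∧
      ∀ a ∈ l,
        (∃ p ∈ s, u.w p = a ∧ (∀ q ∈ s, u.w q = a → p ≤ q) ∧
          Approx u n (s ∩ Set.Iio p) (xl a l) ∧ Approx u n (s ∩ Set.Ioi p) (xr a l)) ∧
        (∃ p ∈ s, u.w p = a ∧ (∀ q ∈ s, u.w q = a → q ≤ p) ∧
          Approx u n (s ∩ Set.Iio p) (yl a l) ∧ Approx u n (s ∩ Set.Ioi p) (yr a l))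

namespace Approx

variable {u v : GWord A} {n : ℕ}

theorem empty (u : GWord A) (n : ℕ) : Approx u n ∅ [] := by
  induction n with
  | zero => trivial
  | succ n ih => exact ⟨by simp, ih, by simp⟩

theorem singleton (u : GWord A) (n : ℕ) (p : u.P) : Approx u n {p} [u.w p] := by
  induction n with
  | zero => trivial
  | succ n ih =>
    have h1 : ({p} : Set u.P) ∩ Set.Iio p = ∅ := by ext; simp
    have h2 : ({p} : Set u.P) ∩ Set.Ioi p = ∅ := by ext; simp
    refine ⟨by simp [eq_comm], ih, fun a ha => ?_⟩
    obtain rfl : a = u.w p := by simpa using ha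
    refine ⟨⟨p, rfl, rfl, by simp, ?_⟩, ⟨p, rfl, rfl, by simp, ?_⟩⟩
    · rw [h1, h2]; simpa [xl, xr] using empty u n
    · rw [h1, h2]; simpa [yl, yr, xl, xr] using empty u n

theorem append {s t : Set u.P} (hst : ∀ p ∈ s, ∀ q ∈ t, p < q) {l l' : List A}
    (hs : Approx u n s l) (ht : Approx u n t l') : Approx u n (s ∪ t) (l ++ l') := by
  induction n generalizing s t l l' with
  | zero => trivial
  | succ n ih =>
    have ⟨hs1, hs2, hs3⟩ := hs
    have ⟨ht1, ht2, ht3⟩ := ht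
    refine ⟨fun a => ?_, ih hst hs2 ht2, fun a ha => ⟨?_, ?_⟩⟩
    · simp only [List.mem_append, hs1, ht1, Set.mem_union, or_and_right, exists_or]
    · by_cases hal : a ∈ l
      · obtain ⟨p, hp, hpa, hmin, hL, hR⟩ := (hs3 a hal).1
        refine ⟨p, Or.inl hp, hpa, ?_, ?_, ?_⟩
        · rintro q (hq | hq) hqa
          exacts [hmin q hq hqa, (hst p hp q hq).le]
        · rw [xl_append_of_mem hal]
          convert hL using 1
          ext q; have := hst p hp q; have := @lt_asymm _ _ p q; simp; tauto
        · rw [xr_append_of_mem hal]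
          convert ih (fun p hp q hq => hst p hp.1 q hq) hR ht2 using 1
          ext q; have := hst p hp q; simp; tauto
      · have hal' : a ∈ l' := by simpa [hal] using ha
        obtain ⟨p, hp, hpa, hmin, hL, hR⟩ := (ht3 a hal').1
        refine ⟨p, Or.inr hp, hpa, ?_, ?_, ?_⟩
        · rintro q (hq | hq) hqa
          exacts [absurd ((hs1 a).2 ⟨q, hq, hqa⟩) hal, hmin q hq hqa]
        · rw [xl_append_of_not_mem hal]
          convert ih (fun p hp q hq => hst p hp q hq.1) hs2 hL using 1
          ext q; have := fun h => hst q h p hp; simp; tauto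
        · rw [xr_append_of_not_mem hal]
          convert hR using 1
          ext q; have := fun h => hst q h p hp; have := @lt_asymm _ _ p q; simp; tauto
    · by_cases hal' : a ∈ l'
      · obtain ⟨p, hp, hpa, hmax, hL, hR⟩ := (ht3 a hal').2
        refine ⟨p, Or.inr hp, hpa, ?_, ?_, ?_⟩
        · rintro q (hq | hq) hqa
          exacts [(hst q hq p hp).le, hmax q hq hqa]
        · rw [yl_append_of_mem l hal']
          convert ih (fun p hp q hq => hst p hp q hq.1) hs2 hL using 1
          ext q; have := fun h => hst q h p hp; simp; tauto
        · rw [yr_append_of_mem l hal']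
          convert hR using 1
          ext q; have := fun h => hst q h p hp; have := @lt_asymm _ _ p q; simp; tauto
      · have hal : a ∈ l := by simpa [hal'] using ha
        obtain ⟨p, hp, hpa, hmax, hL, hR⟩ := (hs3 a hal).2
        refine ⟨p, Or.inl hp, hpa, ?_, ?_, ?_⟩
        · rintro q (hq | hq) hqa
          exacts [hmax q hq hqa, absurd ((ht1 a).2 ⟨q, hq, hqa⟩) hal']
        · rw [yl_append_of_not_mem l hal']
          convert hL using 1
          ext q; have := hst p hp q; have := @lt_asymm _ _ p q; simp; tauto
        · rw [yr_append_of_not_mem l hal']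
          convert ih (fun p hp q hq => hst p hp.1 q hq) hR ht2 using 1
          ext q; have := hst p hp q; simp; tauto

theorem image_iff {f : u.P → v.P} (hf : StrictMono f) (hw : ∀ p, v.w (f p) = u.w p)
    {s : Set u.P} {l : List A} : Approx v n (f '' s) l ↔ Approx u n s l := by
  induction n generalizing s l with
  | zero => exact Iff.rfl
  | succ n ih =>
    have h1 : ∀ p, f '' s ∩ Set.Iio (f p) = f '' (s ∩ Set.Iio p) := by
      intro p; ext q; simp only [Set.mem_inter_iff, Set.mem_image, Set.mem_Iio]
      constructor
      · rintro ⟨⟨r, hr, rfl⟩, h⟩; exact ⟨r, ⟨hr, hf.lt_iff_lt.1 h⟩, rfl⟩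
      · rintro ⟨r, ⟨hr, h⟩, rfl⟩; exact ⟨⟨r, hr, rfl⟩, hf h⟩
    have h2 : ∀ p, f '' s ∩ Set.Ioi (f p) = f '' (s ∩ Set.Ioi p) := by
      intro p; ext q; simp only [Set.mem_inter_iff, Set.mem_image, Set.mem_Ioi]
      constructor
      · rintro ⟨⟨r, hr, rfl⟩, h⟩; exact ⟨r, ⟨hr, hf.lt_iff_lt.1 h⟩, rfl⟩
      · rintro ⟨r, ⟨hr, h⟩, rfl⟩; exact ⟨⟨r, hr, rfl⟩, hf h⟩
    simp only [Approx, Set.exists_mem_image, Set.forall_mem_image, h1, h2, ih, hw, hf.le_iff_le]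

theorem range_iff {f : u.P → v.P} (hf : StrictMono f) (hw : ∀ p, v.w (f p) = u.w p)
    {l : List A} : Approx v n (Set.range f) l ↔ Approx u n Set.univ l := by
  rw [← Set.image_univ, image_iff hf hw]

theorem restrict_iff {s : Set u.P} {l : List A} :
    Approx (u.restrict s) n Set.univ l ↔ Approx u n s l := by
  have := range_iff (n := n) (u := u.restrict s) (v := u) (f := fun p => p.1)
    (fun _ _ h => h) (fun _ => rfl) (l := l)
  rw [← this, show Set.range (fun p : (u.restrict s).P => p.1) = s from Subtype.range_coe]

theorem range_list {l : List A} {f : Fin l.length → u.P} (hf : StrictMono f)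
    (hw : ∀ i, u.w (f i) = l.get i) : Approx u n (Set.range f) l := by
  induction l with
  | nil => simpa [Set.range_eq_empty] using empty u n
  | cons a l ih =>
    have h : Set.range f = {f 0} ∪ Set.range (fun i : Fin l.length => f i.succ) := by
      ext q; simp only [Set.mem_range, Set.mem_union, Set.mem_singleton_iff]
      exact Fin.exists_fin_succ.trans (by simp [eq_comm])
    rw [h]
    have h0 : u.w (f 0) = a := hw 0
    refine append (l := [a]) ?_ (h0 ▸ singleton u n (f 0))
      (ih (fun i j hij => hf (Fin.succ_lt_succ_iff.2 hij)) fun i => hw i.succ)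
    rintro p rfl _ ⟨i, rfl⟩
    exact hf (Fin.succ_pos i)

theorem ofList (l : List A) (n : ℕ) : Approx (GWord.ofList l) n Set.univ l := by
  rw [← Set.range_id]
  exact range_list (u := GWord.ofList l) strictMono_id fun _ => rfl

/-- The successor map on the `ω` part of `ω + ω*`. -/
def succLeft : OO → OO := fun i => Sum.elim (fun n => Sum.inlₗ (n + 1)) Sum.inrₗ (ofLex i)

/-- The predecessor map on the `ω*` part of `ω + ω*`. -/
def predRight : OO → OO :=
  fun i => Sum.elim Sum.inlₗ (fun n => Sum.inrₗ (OrderDual.toDual (OrderDual.ofDual n + 1))) (ofLex i)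

theorem succLeft_strictMono : StrictMono succLeft := by
  rintro (i | i) (j | j) h
  · exact Sum.Lex.inl_lt_inl_iff.2 (Nat.succ_lt_succ (Sum.Lex.inl_lt_inl_iff.1 h))
  · exact Sum.Lex.inl_lt_inr _ _
  · exact absurd h Sum.Lex.not_inr_lt_inl
  · exact h

theorem predRight_strictMono : StrictMono predRight := by
  rintro (i | i) (j | j) h
  · exact h
  · exact Sum.Lex.inl_lt_inr _ _
  · exact absurd h Sum.Lex.not_inr_lt_inl
  · have hij : i < j := Sum.Lex.inr_lt_inr_iff.1 h
    exact Sum.Lex.inr_lt_inr_iff.2 (OrderDual.toDual_lt_toDual.2 (Nat.succ_lt_succ hij))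

theorem eq_or_mem_range_succLeft (i : OO) : i = Sum.inlₗ 0 ∨ ∃ j, i = succLeft j := by
  rcases i with (_ | i) | i
  · exact Or.inl rfl
  · exact Or.inr ⟨Sum.inlₗ i, rfl⟩
  · exact Or.inr ⟨Sum.inrₗ i, rfl⟩

theorem eq_or_mem_range_predRight (i : OO) :
    i = Sum.inrₗ (OrderDual.toDual 0) ∨ ∃ j, i = predRight j := by
  rcases i with i | i
  · exact Or.inr ⟨Sum.inlₗ i, rfl⟩
  · rcases h : OrderDual.ofDual i with _ | j
    · exact Or.inl (congrArg _ h)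
    · exact Or.inr ⟨Sum.inrₗ (OrderDual.toDual j), congrArg _ h⟩

theorem inl_zero_lt_succLeft (j : OO) : Sum.inlₗ 0 < succLeft j := by
  rcases j with j | j
  · exact Sum.Lex.inl_lt_inl_iff.2 (Nat.succ_pos j)
  · exact Sum.Lex.inl_lt_inr _ _

theorem predRight_lt_inr_zero (j : OO) : predRight j < Sum.inrₗ (OrderDual.toDual 0) := by
  rcases j with j | j
  · exact Sum.Lex.inl_lt_inr _ _
  · exact Sum.Lex.inr_lt_inr_iff.2 (OrderDual.toDual_lt_toDual.2 (Nat.succ_pos _))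

theorem iUnion_npow {s : OO → Set u.P} (hs : ∀ i j, i < j → ∀ p ∈ s i, ∀ q ∈ s j, p < q)
    {l : List A} (hl : ∀ i, Approx u n (s i) l) {k : ℕ} (hk : n ≤ k) :
    Approx u n (⋃ i, s i) (listNPow l k) := by
  induction n generalizing s k with
  | zero => trivial
  | succ n ih =>
    obtain ⟨k, rfl⟩ : ∃ j, k = j + 1 := ⟨k - 1, by omega⟩
    refine ⟨fun a => ⟨fun ha => ?_, ?_⟩, ih hs (fun i => (hl i).2.1) (by omega), fun a ha => ?_⟩
    · obtain ⟨p, hp, hpa⟩ := ((hl (Sum.inlₗ 0)).1 a).1 (mem_listNPow ha)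
      exact ⟨p, Set.mem_iUnion.2 ⟨_, hp⟩, hpa⟩
    · rintro ⟨p, hp, hpa⟩
      obtain ⟨i, hi⟩ := Set.mem_iUnion.1 hp
      exact List.mem_append_left _ (((hl i).1 a).2 ⟨p, hi, hpa⟩)
    have hal := mem_listNPow ha
    constructor
    · have hS : (⋃ i, s i) = s (Sum.inlₗ 0) ∪ ⋃ j, s (succLeft j) := by
        ext q
        simp only [Set.mem_iUnion, Set.mem_union]
        constructor
        · rintro ⟨i, hi⟩
          obtain rfl | ⟨j, rfl⟩ := eq_or_mem_range_succLeft i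
          exacts [Or.inl hi, Or.inr ⟨j, hi⟩]
        · rintro (h | ⟨j, h⟩)
          exacts [⟨_, h⟩, ⟨_, h⟩]
      have hlt : ∀ p ∈ s (Sum.inlₗ 0), ∀ q ∈ ⋃ j, s (succLeft j), p < q := by
        intro p hp q hq
        obtain ⟨j, hj⟩ := Set.mem_iUnion.1 hq
        exact hs _ _ (inl_zero_lt_succLeft j) p hp q hj
      have htail := ih (s := fun j => s (succLeft j))
        (fun i j hij => hs _ _ (succLeft_strictMono hij)) (fun i => (hl _).2.1)
        (show n ≤ k by omega)
      obtain ⟨p, hp, hpa, hmin, hL, hR⟩ := ((hl (Sum.inlₗ 0)).2.2 a hal).1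
      rw [hS, listNPow, xl_append_of_mem hal, xr_append_of_mem hal]
      refine ⟨p, Or.inl hp, hpa, ?_, ?_, ?_⟩
      · rintro q (hq | hq) hqa
        exacts [hmin q hq hqa, (hlt p hp q hq).le]
      · convert hL using 1
        ext q
        have := hlt p hp q
        have := @lt_asymm _ _ p q
        simp only [Set.mem_inter_iff, Set.mem_union, Set.mem_Iio]
        tauto
      · convert append (fun p hp q hq => hlt p hp.1 q hq) hR htail using 1
        ext q
        have := hlt p hp q
        simp only [Set.mem_inter_iff, Set.mem_union, Set.mem_Ioi]
        tauto
    · have hS : (⋃ i, s i) = (⋃ j, s (predRight j)) ∪ s (Sum.inrₗ (OrderDual.toDual 0)) := by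
        ext q
        simp only [Set.mem_iUnion, Set.mem_union]
        constructor
        · rintro ⟨i, hi⟩
          obtain rfl | ⟨j, rfl⟩ := eq_or_mem_range_predRight i
          exacts [Or.inr hi, Or.inl ⟨j, hi⟩]
        · rintro (⟨j, h⟩ | h)
          exacts [⟨_, h⟩, ⟨_, h⟩]
      have hlt : ∀ p ∈ ⋃ j, s (predRight j), ∀ q ∈ s (Sum.inrₗ (OrderDual.toDual 0)), p < q := by
        intro p hp q hq
        obtain ⟨j, hj⟩ := Set.mem_iUnion.1 hp
        exact hs _ _ (predRight_lt_inr_zero j) p hj q hq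
      have hinit := ih (s := fun j => s (predRight j))
        (fun i j hij => hs _ _ (predRight_strictMono hij)) (fun i => (hl _).2.1)
        (show n ≤ k by omega)
      obtain ⟨p, hp, hpa, hmax, hL, hR⟩ := ((hl (Sum.inrₗ (OrderDual.toDual 0))).2.2 a hal).2
      rw [hS, listNPow_succ', yl_append_of_mem _ hal, yr_append_of_mem _ hal]
      refine ⟨p, Or.inr hp, hpa, ?_, ?_, ?_⟩
      · rintro q (hq | hq) hqa
        exacts [(hlt q hq p hp).le, hmax q hq hqa]
      · convert append (fun p hp q hq => hlt p hp q hq.1) hinit hL using 1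
        ext q
        have := fun h => hlt q h p hp
        simp only [Set.mem_inter_iff, Set.mem_union, Set.mem_Iio]
        tauto
      · convert hR using 1
        ext q
        have := fun h => hlt q h p hp
        have := @lt_asymm _ _ p q
        simp only [Set.mem_inter_iff, Set.mem_union, Set.mem_Ioi]
        tauto

theorem substOO (α : PiTerm A) {k : ℕ} (hk : n ≤ k) :
    Approx α.substOO n Set.univ (α.substNat k) := by
  induction α with
  | eps => exact ofList [] n
  | letter a => exact ofList [a] n
  | mul α β ihα ihβ =>
    have hl := (range_iff (v := α.substOO.append β.substOO) (f := Sum.inlₗ)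
      Sum.Lex.inl_strictMono fun _ => rfl).2 ihα
    have hr := (range_iff (v := α.substOO.append β.substOO) (f := Sum.inrₗ)
      Sum.Lex.inr_strictMono fun _ => rfl).2 ihβ
    have huniv : (Set.univ : Set (α.substOO.append β.substOO).P) =
        Set.range Sum.inlₗ ∪ Set.range Sum.inrₗ := by
      refine (Set.eq_univ_of_forall ?_).symm
      rintro (p | p)
      exacts [Or.inl ⟨p, rfl⟩, Or.inr ⟨p, rfl⟩]
    change Approx (α.substOO.append β.substOO) n Set.univ (α.substNat k ++ β.substNat k)
    rw [huniv]
    refine append ?_ hl hr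
    rintro _ ⟨p, rfl⟩ _ ⟨q, rfl⟩
    exact Sum.Lex.inl_lt_inr p q
  | pi γ ih =>
    have hmono : ∀ i : OO, StrictMono fun p : γ.substOO.P => toLex (i, p) := fun i p q hpq =>
      Prod.Lex.toLex_lt_toLex.2 (Or.inr ⟨rfl, hpq⟩)
    have huniv : (Set.univ : Set (γ.substOO.gpow OO).P) =
        ⋃ i : OO, Set.range fun p : γ.substOO.P => toLex (i, p) := by
      refine (Set.eq_univ_of_forall fun p => ?_).symm
      exact Set.mem_iUnion.2 ⟨(ofLex p).1, (ofLex p).2, rfl⟩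
    change Approx (γ.substOO.gpow OO) n Set.univ (listNPow (γ.substNat k) k)
    rw [huniv]
    refine iUnion_npow (u := γ.substOO.gpow OO) ?_
      (fun i => (range_iff (v := γ.substOO.gpow OO) (hmono i) fun _ => rfl).2 ih) hk
    rintro i j hij _ ⟨p, rfl⟩ _ ⟨q, rfl⟩
    exact Prod.Lex.toLex_lt_toLex.2 (Or.inl hij)

theorem alph_eq {l : List A} (h : Approx u (n + 1) Set.univ l) :
    u.alph = {a | a ∈ l} := by
  ext a
  simp [GWord.alph, h.1 a]

theorem factors {l : List A} (h : Approx u (n + 1) Set.univ l) {a : A} (ha : a ∈ l) :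
    (Approx (u.XL a) n Set.univ (xl a l) ∧ Approx (u.XR a) n Set.univ (xr a l)) ∧
      Approx (u.YL a) n Set.univ (yl a l) ∧ Approx (u.YR a) n Set.univ (yr a l) := by
  obtain ⟨⟨p, -, hpa, hmin, hL, hR⟩, ⟨q, -, hqa, hmax, hL', hR'⟩⟩ := h.2.2 a ha
  have hf : ∃ p, u.IsFirst a p := ⟨p, hpa, fun q => hmin q trivial⟩
  have hl : ∃ p, u.IsLast a p := ⟨q, hqa, fun r => hmax r trivial⟩
  have hp : hf.choose = p :=
    le_antisymm (hf.choose_spec.2 p hpa) (hmin _ trivial hf.choose_spec.1)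
  have hq : hl.choose = q :=
    le_antisymm (hmax _ trivial hl.choose_spec.1) (hl.choose_spec.2 q hqa)
  have hXL : u.XL a = u.restrict (Set.Iio p) := by rw [GWord.XL, dif_pos hf, hp]; rfl
  have hXR : u.XR a = u.restrict (Set.Ioi p) := by rw [GWord.XR, dif_pos hf, hp]; rfl
  have hYL : u.YL a = u.restrict (Set.Iio q) := by rw [GWord.YL, dif_pos hl, hq]; rfl
  have hYR : u.YR a = u.restrict (Set.Ioi q) := by rw [GWord.YR, dif_pos hl, hq]; rfl
  rw [Set.univ_inter] at hL hR hL' hR'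
  rw [hXL, hXR, hYL, hYR]
  exact ⟨⟨restrict_iff.2 hL, restrict_iff.2 hR⟩, restrict_iff.2 hL', restrict_iff.2 hR'⟩

theorem eqvAux_iff {m : ℕ} {l l' : List A} (h : Approx u n Set.univ l)
    (h' : Approx v n Set.univ l') :
    (eqvAux n ZK.X m u v ↔ XEquiv n m l l') ∧
      (eqvAux n ZK.Y m u v ↔ XEquiv n m l.reverse l'.reverse) := by
  induction n generalizing u v m l l' with
  | zero => simp [eqvAux, XEquiv]
  | succ n ih =>
    cases m with
    | zero => simp [eqvAux, XEquiv]
    | succ m =>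
      simp only [eqvAux, XEquiv, h.alph_eq, h'.alph_eq, Set.ext_iff, Set.mem_ofPred_eq,
        List.mem_reverse, List.reverse_reverse]
      refine ⟨and_congr_right fun hmem => and_congr (ih h.2.1 h'.2.1).2 ?_,
        and_congr_right fun hmem => and_congr (ih h.2.1 h'.2.1).1 ?_⟩
      · refine forall₂_congr fun a ha => ?_
        have hf := h.factors ha
        have hf' := h'.factors ((hmem a).1 ha)
        exact and_congr (ih hf.1.1 hf'.1.1).2 (ih hf.1.2 hf'.1.2).1
      · refine forall₂_congr fun a ha => ?_
        have hf := h.factors ha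
        have hf' := h'.factors ((hmem a).1 ha)
        refine (and_congr (ih hf.2.1 hf'.2.1).2 (ih hf.2.2 hf'.2.2).1).trans ?_
        simp only [yl, yr, List.reverse_reverse, and_comm]

end Approx

/-! ## Idempotents along infinite chains -/

theorem eventually_eq_const {ι κ : Type*} [Finite κ] (U : Ultrafilter ι) (f : ι → κ) :
    ∃ c, ∀ᶠ i in U, f i = c := by
  obtain ⟨c, hc⟩ := Ultrafilter.eq_pure_of_finite (U.map f)
  have h : {c} ∈ U.map f := by rw [hc]; exact Ultrafilter.mem_pure.2 rfl
  exact ⟨c, h⟩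

/-- A special case of Ramsey's theorem: every infinite product over a finite monoid has an
idempotent factor. -/
theorem exists_idempotent_factor {M : Type*} [Monoid M] [Finite M] (p : ℕ → ℕ → M)
    (hp : ∀ i j k, i < j → j < k → p i j * p j k = p i k) :
    ∃ i j, i < j ∧ p i j * p i j = p i j := by
  let U : Ultrafilter ℕ := Filter.hyperfilter ℕ
  have hU : ∀ i : ℕ, ∀ᶠ j : ℕ in U, i < j := fun i =>
    Nat.hyperfilter_le_atTop (Filter.eventually_gt_atTop i)
  choose c hc using fun i => eventually_eq_const U (p i)
  obtain ⟨e, he⟩ := eventually_eq_const U c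
  obtain ⟨i, hi⟩ := he.exists
  obtain ⟨j, hij, hj, hpij⟩ := ((hU i).and (he.and (hc i))).exists
  obtain ⟨k, hjk, hpik, hpjk⟩ := ((hU j).and ((hc i).and (hc j))).exists
  refine ⟨i, j, hij, ?_⟩
  have := hp i j k hij hjk
  rw [hpik, hpjk, hpij, hi, hj] at this
  rw [hpij, hi, this]

theorem exists_idempotent_step {S M : Type*} [Monoid M] [Finite M] {R : S → M → S → Prop}
    (hR : ∀ s x t y r, R s x t → R t y r → R s (x * y) r) {P : S → Prop}
    (h : ∀ s, P s → ∃ x t, R s x t ∧ P t) {s : S} (hs : P s) :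
    ∃ t e t', P t ∧ P t' ∧ R t e t' ∧ e * e = e := by
  choose x next hstep using fun s : Subtype P => h s.1 s.2
  let f : ℕ → Subtype P := fun n =>
    Nat.rec ⟨s, hs⟩ (fun _ t => ⟨next t, (hstep t).2⟩) n
  let p : ℕ → ℕ → M := fun i j => ((List.range' i (j - i)).map fun n => x (f n)).prod
  have hp : ∀ i j k, i < j → j < k → p i j * p j k = p i k := by
    intro i j k hij hjk
    have := List.range'_append_1 (s := i) (m := j - i) (n := k - j)
    rw [show i + (j - i) = j by omega, show j - i + (k - j) = k - i by omega] at this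
    simp only [p, ← this, List.map_append, List.prod_append]
  have hsucc : ∀ i, R (f i).1 (p i (i + 1)) (f (i + 1)).1 := by
    intro i
    have : p i (i + 1) = x (f i) := by simp [p]
    rw [this]
    exact (hstep (f i)).1
  have hRp : ∀ i d, R (f i).1 (p i (i + d + 1)) (f (i + d + 1)).1 := by
    intro i d
    induction d with
    | zero => exact hsucc i
    | succ d ih =>
      rw [← hp i (i + d + 1) (i + (d + 1) + 1) (by omega) (by omega)]
      exact hR _ _ _ _ _ ih (hsucc (i + d + 1))
  obtain ⟨i, j, hij, hidem⟩ := exists_idempotent_factor p hp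
  obtain ⟨d, rfl⟩ : ∃ d, j = i + d + 1 := ⟨j - i - 1, by omega⟩
  exact ⟨_, _, _, (f i).2, (f (i + d + 1)).2, hRp i d, hidem⟩

/-! ## Operations on π-terms -/

/-- The π-term of a finite word. -/
def ofWord : List A → PiTerm A
  | [] => .eps
  | a :: l => .mul (.letter a) (ofWord l)

@[simp] theorem substNat_ofWord (l : List A) (k : ℕ) : (ofWord l).substNat k = l := by
  induction l with
  | nil => rfl
  | cons a l ih => simp [ofWord, PiTerm.substNat, ih]

/-- The mirror image of a π-term. -/
def revTerm : PiTerm A → PiTerm A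
  | .eps => .eps
  | .letter a => .letter a
  | .mul α β => .mul (revTerm β) (revTerm α)
  | .pi γ => .pi (revTerm γ)

theorem reverse_listNPow (l : List A) (k : ℕ) :
    (listNPow l k).reverse = listNPow l.reverse k := by
  induction k with
  | zero => rfl
  | succ k ih => rw [listNPow, List.reverse_append, ih, ← listNPow_succ']

@[simp] theorem substNat_revTerm (α : PiTerm A) (k : ℕ) :
    (revTerm α).substNat k = (α.substNat k).reverse := by
  induction α with
  | eps => rfl
  | letter a => rfl
  | mul α β ihα ihβ => simp [revTerm, PiTerm.substNat, ihα, ihβ]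
  | pi γ ih => simp [revTerm, PiTerm.substNat, ih, reverse_listNPow]

/-- All instances `[α]_k` with `k ≥ 1` have alphabet `B`. -/
def HasAlph (α : PiTerm A) (B : Set A) : Prop :=
  ∀ k, 1 ≤ k → ∀ a, a ∈ α.substNat k ↔ a ∈ B

theorem hasAlph_ofWord (l : List A) : HasAlph (ofWord l) {a | a ∈ l} := by
  intro k _ a; simp

theorem HasAlph.mul {α β : PiTerm A} {B C : Set A} (hα : HasAlph α B) (hβ : HasAlph β C) :
    HasAlph (.mul α β) (B ∪ C) := by
  intro k hk a
  simp [PiTerm.substNat, hα k hk a, hβ k hk a]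

theorem HasAlph.pi {γ : PiTerm A} {B : Set A} (h : HasAlph γ B) : HasAlph (.pi γ) B := by
  intro k hk a
  rw [← h k hk a]
  refine ⟨mem_listNPow, fun ha => ?_⟩
  obtain ⟨j, rfl⟩ : ∃ j, k = j + 1 := ⟨k - 1, by omega⟩
  exact List.mem_append_left _ ha

theorem HasAlph.rev {γ : PiTerm A} {B : Set A} (h : HasAlph γ B) : HasAlph (revTerm γ) B := by
  intro k hk a
  simp [h k hk a]

/-- A homomorphism from finite words to a monoid. -/
structure IsWordHom {M : Type} [Monoid M] (φ : List A → M) : Prop where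
  nil : φ [] = 1
  append : ∀ u v, φ (u ++ v) = φ u * φ v

theorem IsWordHom.npow {M : Type} [Monoid M] {φ : List A → M} (hφ : IsWordHom φ) (l : List A)
    (k : ℕ) : φ (listNPow l k) = φ l ^ k := by
  induction k with
  | zero => simp [listNPow, hφ.nil]
  | succ k ih => rw [listNPow, hφ.append, ih, pow_succ']

theorem IsWordHom.npow_of_idempotent {M : Type} [Monoid M] {φ : List A → M}
    (hφ : IsWordHom φ) {l : List A} (h : φ l * φ l = φ l) {k : ℕ} (hk : 1 ≤ k) :
    φ (listNPow l k) = φ l := by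
  rw [hφ.npow]
  exact IsIdempotentElem.pow_eq h (by omega)

theorem IsWordHom.rev {M : Type} [Monoid M] {φ : List A → M} (hφ : IsWordHom φ) :
    IsWordHom fun l => MulOpposite.op (φ l.reverse) :=
  ⟨by simp [hφ.nil], fun u v => by simp [hφ.append]⟩

/-! ## Words with many full-alphabet factors -/

/-- `l` is a word over `B` with a prefix consisting of `K` factors of alphabet `B`. -/
def Rich (B : Set A) : ℕ → List A → Prop
  | 0, l => ∀ a ∈ l, a ∈ B
  | K + 1, l => ∃ p q, l = p ++ q ∧ (∀ a, a ∈ p ↔ a ∈ B) ∧ Rich B K q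

theorem Rich.mem {B : Set A} {K : ℕ} {l : List A} (h : Rich B K l) {a : A} (ha : a ∈ l) :
    a ∈ B := by
  induction K generalizing l with
  | zero => exact h a ha
  | succ K ih =>
    obtain ⟨p, q, rfl, hp, hq⟩ := h
    rcases List.mem_append.1 ha with h | h
    exacts [(hp a).1 h, ih hq h]

theorem Rich.append_left {B : Set A} {K : ℕ} {l p : List A} (h : Rich B K l)
    (hp : ∀ a ∈ p, a ∈ B) : Rich B K (p ++ l) := by
  cases K with
  | zero => exact fun a ha => (List.mem_append.1 ha).elim (hp a) (h a)
  | succ K =>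
    obtain ⟨p', q, rfl, hp', hq⟩ := h
    exact ⟨p ++ p', q, by simp, fun a => by have := hp a; simp [hp']; tauto, hq⟩

theorem Rich.npow {B : Set A} {l s : List A} (hl : ∀ a, a ∈ l ↔ a ∈ B) (hs : ∀ a ∈ s, a ∈ B)
    (k : ℕ) : Rich B k (listNPow l k ++ s) := by
  induction k with
  | zero => exact hs
  | succ k ih => exact ⟨l, _, List.append_assoc _ _ _, hl, ih⟩

theorem Rich.xEquiv {B : Set A} {K : ℕ} {l l' : List A} (h : Rich B K l) (h' : Rich B K l') :
    XEquiv K 1 l l' := by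
  induction K generalizing l l' with
  | zero => trivial
  | succ K ih =>
    obtain ⟨p, q, rfl, hp, hq⟩ := h
    obtain ⟨p', q', rfl, hp', hq'⟩ := h'
    have hmem : ∀ (w s : List A), (∀ a, a ∈ w ↔ a ∈ B) → Rich B K s →
        ∀ a, a ∈ w ++ s ↔ a ∈ B := fun w s hw hs a =>
      ⟨fun ha => (List.mem_append.1 ha).elim (hw a).1 hs.mem,
        fun ha => List.mem_append_left _ ((hw a).2 ha)⟩
    refine ⟨fun a => by rw [hmem p q hp hq, hmem p' q' hp' hq'], by simp, fun a ha => ?_⟩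
    have haB := (hmem p q hp hq a).1 ha
    rw [xr_append_of_mem ((hp a).2 haB), xr_append_of_mem ((hp' a).2 haB)]
    exact ⟨by simp, ih (hq.append_left fun b hb => (hp b).1 (xr_subset _ _ hb))
      (hq'.append_left fun b hb => (hp' b).1 (xr_subset _ _ hb))⟩

/-! ## Families of words along an ultrafilter -/

section Ultrafilter

variable {ι : Type} {U : Ultrafilter ι} {M : Type} {φ : List A → M} {N : ℕ}

/-- The π-term `α` is the limit along `U` of the family of words `u`, with respect to `φ` and
the relations `≡_{1,n}^X`. -/
def IsLimitTerm (U : Ultrafilter ι) (φ : List A → M) (N : ℕ) (B : Set A) (u : ι → List A)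
    (α : PiTerm A) : Prop :=
  HasAlph α B ∧ (∀ᶠ i in U, φ (u i) = φ (α.substNat N)) ∧
    ∀ k, ∀ᶠ i in U, XEquiv k 1 (α.substNat k) (u i)

theorem IsLimitTerm.mul [Monoid M] (hφ : IsWordHom φ) {B C : Set A} {u v : ι → List A} {α β : PiTerm A}
    (hu : IsLimitTerm U φ N B u α) (hv : IsLimitTerm U φ N C v β) :
    IsLimitTerm U φ N (B ∪ C) (fun i => u i ++ v i) (.mul α β) := by
  refine ⟨hu.1.mul hv.1, ?_, fun k => ?_⟩
  · filter_upwards [hu.2.1, hv.2.1] with i h1 h2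
    rw [hφ.append, h1, h2, PiTerm.substNat, hφ.append]
  · filter_upwards [hu.2.2 k, hv.2.2 k] with i h1 h2
    exact h1.append h2

theorem IsLimitTerm.congr {B : Set A} {u v : ι → List A} {α : PiTerm A}
    (hu : IsLimitTerm U φ N B u α) (h : ∀ᶠ i in U, u i = v i) :
    IsLimitTerm U φ N B v α := by
  refine ⟨hu.1, ?_, fun k => ?_⟩
  · filter_upwards [hu.2.1, h] with i h1 h2
    rw [← h2, h1]
  · filter_upwards [hu.2.2 k, h] with i h1 h2
    rwa [← h2]

theorem isLimitTerm_ofWord (l : List A) :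
    IsLimitTerm U φ N {a | a ∈ l} (fun _ => l) (ofWord l) :=
  ⟨hasAlph_ofWord l, by simp, fun k => by simp [XEquiv.refl]⟩

/-- The first full-alphabet factor of a family of words with constant nonempty alphabet. -/
theorem exists_first_arch_family [Finite A] {B : Set A} (hB : B.Nonempty) {u : ι → List A}
    (hu : ∀ᶠ i in U, ∀ a, a ∈ u i ↔ a ∈ B) :
    ∃ a ∈ B, ∃ C ⊆ B, (∀ᶠ i in U, xl a (u i) ++ [a] ++ xr a (u i) = u i) ∧
      (∀ᶠ i in U, ∀ b, b ∈ xl a (u i) ↔ b ∈ B \ {a}) ∧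
      ∀ᶠ i in U, ∀ b, b ∈ xr a (u i) ↔ b ∈ C := by
  obtain ⟨b₀, hb₀⟩ := hB
  have h : ∀ i, ∃ a, (∀ b, b ∈ u i ↔ b ∈ B) → a ∈ B ∧ ∀ b ∈ B, b = a ∨ b ∈ xl a (u i) := by
    intro i
    by_cases hi : ∀ b, b ∈ u i ↔ b ∈ B
    · obtain ⟨a, ha, hb⟩ := exists_first_arch (List.ne_nil_of_mem ((hi b₀).2 hb₀))
      exact ⟨a, fun _ => ⟨(hi a).1 ha, fun b hbB => hb b ((hi b).2 hbB)⟩⟩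
    · exact ⟨b₀, fun h => absurd h hi⟩
  choose f hf using h
  obtain ⟨a, ha⟩ := eventually_eq_const U f
  obtain ⟨C, hC⟩ := eventually_eq_const U fun i => {b | b ∈ xr a (u i)}
  have key : ∀ᶠ i in U, a ∈ B ∧ C ⊆ B ∧ xl a (u i) ++ [a] ++ xr a (u i) = u i ∧
      (∀ b, b ∈ xl a (u i) ↔ b ∈ B \ {a}) ∧ ∀ b, b ∈ xr a (u i) ↔ b ∈ C := by
    filter_upwards [ha, hC, hu] with i hai hCi hui
    obtain ⟨haB, hb⟩ := hf i hui
    rw [hai] at haB hb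
    refine ⟨haB, ?_, by simpa using xl_append_cons_xr ((hui a).2 haB), fun b => ?_, fun b => ?_⟩
    · rw [← hCi]
      exact fun b hb => (hui b).1 (xr_subset _ _ hb)
    · constructor
      · intro h
        exact ⟨(hui b).1 (xl_subset _ _ h), fun hba => not_mem_xl a (u i) (hba ▸ h)⟩
      · rintro ⟨h1, h2⟩
        exact (hb b h1).resolve_left h2
    · rw [← hCi]
      rfl
  obtain ⟨i, hi⟩ := key.exists
  exact ⟨a, hi.1, C, hi.2.1, key.mono fun _ h => h.2.2.1, key.mono fun _ h => h.2.2.2.1,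
    key.mono fun _ h => h.2.2.2.2⟩

theorem diff_singleton_lt {B : Set A} {a : A} (ha : a ∈ B) : B \ {a} < B :=
  ⟨Set.sdiff_subset, fun h => (h ha).2 rfl⟩

theorem diff_union_singleton {B : Set A} {a : A} (ha : a ∈ B) : B \ {a} ∪ {b | b ∈ [a]} = B := by
  ext b
  by_cases hb : b = a <;> simp [hb, ha]

theorem exists_isLimitTerm [Finite A] [Monoid M] [Finite M] (hφ : IsWordHom φ) (hN : 1 ≤ N) (B : Set A)
    {u : ι → List A} (hu : ∀ᶠ i in U, ∀ a, a ∈ u i ↔ a ∈ B) :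
    ∃ α, IsLimitTerm U φ N B u α := by
  induction B using WellFoundedLT.induction generalizing u with
  | ind B ihB =>
  by_contra hcon
  rcases B.eq_empty_or_nonempty with rfl | hB
  · refine hcon ⟨_, IsLimitTerm.congr (u := fun _ => []) (by simpa using isLimitTerm_ofWord []) ?_⟩
    filter_upwards [hu] with i hi
    exact (List.eq_nil_iff_forall_not_mem.2 fun a ha => (hi a).1 ha).symm
  let P : (ι → List A) → Prop := fun u =>
    (∀ᶠ i in U, ∀ a, a ∈ u i ↔ a ∈ B) ∧ ¬ ∃ α, IsLimitTerm U φ N B u α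
  let R : (ι → List A) → M → (ι → List A) → Prop := fun u x v =>
    ∀ᶠ i in U, ∃ w, (∀ a, a ∈ w ↔ a ∈ B) ∧ u i = w ++ v i ∧ φ w = x
  have hR : ∀ s x t y r, R s x t → R t y r → R s (x * y) r := by
    intro s x t y r h1 h2
    filter_upwards [h1, h2] with i ⟨w, hw, hs, hx⟩ ⟨w', hw', ht, hy⟩
    exact ⟨w ++ w', fun a => by simp [hw, hw'], by simp [hs, ht], by rw [hφ.append, hx, hy]⟩
  have hstep : ∀ s, P s → ∃ x t, R s x t ∧ P t := by
    rintro s ⟨hs, hbad⟩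
    obtain ⟨a, ha, C, hCB, hdec, hl, hr⟩ := exists_first_arch_family hB hs
    obtain ⟨α, hα⟩ := ihB _ (diff_singleton_lt ha) hl
    have hαa := hα.mul hφ (isLimitTerm_ofWord [a])
    rw [diff_union_singleton ha] at hαa
    have hno : ¬ ∃ β, IsLimitTerm U φ N C (fun i => xr a (s i)) β := by
      rintro ⟨β, hβ⟩
      have := (hαa.mul hφ hβ).congr hdec
      rw [Set.union_eq_left.2 hCB] at this
      exact hbad ⟨_, this⟩
    obtain rfl : C = B := by
      by_contra hne
      exact hno (ihB C (lt_of_le_of_ne hCB hne) hr)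
    refine ⟨φ ((PiTerm.mul α (ofWord [a])).substNat N), fun i => xr a (s i), ?_, hr, hno⟩
    · filter_upwards [hdec, hl, hαa.2.1] with i h1 h2 h3
      refine ⟨_, fun b => ?_, h1.symm, h3⟩
      have := h2 b
      by_cases hb : b = a <;> simp_all
  have hrich : ∀ k s, P s → ∀ᶠ i in U, Rich B k (s i) := by
    intro k
    induction k with
    | zero => exact fun s hs => hs.1.mono fun i hi a => (hi a).1
    | succ k ihk =>
      intro s hs
      obtain ⟨x, t, hst, ht⟩ := hstep s hs
      filter_upwards [hst, ihk t ht] with i ⟨w, hw, hsi, _⟩ hi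
      exact ⟨w, t i, hsi, hw, hi⟩
  obtain ⟨s, e, t, hs, ht, hst, he⟩ := exists_idempotent_step hR hstep ⟨hu, hcon⟩
  obtain ⟨c, hc⟩ := eventually_eq_const U fun i => φ (s i)
  obtain ⟨i, ⟨w, hw, hsi, hwe⟩, hci, hti⟩ := (hst.and (hc.and ht.1)).exists
  have hwB : {a | a ∈ w} = B := Set.ext hw
  have htB : {a | a ∈ t i} = B := Set.ext hti
  refine hs.2 ⟨.mul (.pi (ofWord w)) (ofWord (t i)), ?_, ?_, fun k => ?_⟩
  · simpa [hwB, htB] using (hasAlph_ofWord w).pi.mul (hasAlph_ofWord (t i))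
  · filter_upwards [hc] with j hj
    subst hwe
    simp only [PiTerm.substNat, substNat_ofWord, hφ.append, hφ.npow_of_idempotent he hN]
    rw [← hφ.append, ← hsi, hj, hci]
  · filter_upwards [hrich k s hs] with j hj
    refine Rich.xEquiv (B := B) ?_ hj
    simp only [PiTerm.substNat, substNat_ofWord]
    exact Rich.npow hw (fun a ha => (hti a).1 ha) k

/-- The π-terms `α`, `β` have the images of `u`, `v` along `U`, and are `≡_m^X`-equivalent. -/
def IsTermPair (U : Ultrafilter ι) (φ : List A → M) (N m : ℕ) (B : Set A) (u v : ι → List A)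
    (α β : PiTerm A) : Prop :=
  (HasAlph α B ∧ HasAlph β B) ∧
    ((∀ᶠ i in U, φ (u i) = φ (α.substNat N)) ∧ ∀ᶠ i in U, φ (v i) = φ (β.substNat N)) ∧
    ∀ k, XEquiv k m (α.substNat k) (β.substNat k)

theorem IsTermPair.mul [Monoid M] (hφ : IsWordHom φ) {m : ℕ} {B C : Set A} {u v u' v' : ι → List A}
    {α β α' β' : PiTerm A} (h : IsTermPair U φ N m B u v α β)
    (h' : IsTermPair U φ N m C u' v' α' β') :
    IsTermPair U φ N m (B ∪ C) (fun i => u i ++ u' i) (fun i => v i ++ v' i)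
      (.mul α α') (.mul β β') := by
  refine ⟨⟨h.1.1.mul h'.1.1, h.1.2.mul h'.1.2⟩, ⟨?_, ?_⟩, fun k => (h.2.2 k).append (h'.2.2 k)⟩
  · filter_upwards [h.2.1.1, h'.2.1.1] with i h1 h2
    rw [hφ.append, h1, h2, PiTerm.substNat, hφ.append]
  · filter_upwards [h.2.1.2, h'.2.1.2] with i h1 h2
    rw [hφ.append, h1, h2, PiTerm.substNat, hφ.append]

theorem IsTermPair.congr {m : ℕ} {B : Set A} {u v u' v' : ι → List A} {α β : PiTerm A}
    (h : IsTermPair U φ N m B u v α β) (hu : ∀ᶠ i in U, u i = u' i)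
    (hv : ∀ᶠ i in U, v i = v' i) : IsTermPair U φ N m B u' v' α β := by
  refine ⟨h.1, ⟨?_, ?_⟩, h.2.2⟩
  · filter_upwards [h.2.1.1, hu] with i h1 h2
    rw [← h2, h1]
  · filter_upwards [h.2.1.2, hv] with i h1 h2
    rw [← h2, h1]

theorem isTermPair_ofWord (m : ℕ) (l : List A) :
    IsTermPair U φ N m {a | a ∈ l} (fun _ => l) (fun _ => l) (ofWord l) (ofWord l) :=
  ⟨⟨hasAlph_ofWord l, hasAlph_ofWord l⟩, by simp, fun k => by simp [XEquiv.refl]⟩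

end Ultrafilter

theorem exists_isTermPair [Finite A] {ι : Type} {U : Ultrafilter ι} {N : ℕ} (hN : 1 ≤ N) (m : ℕ)
    {M : Type} [Monoid M] [Finite M] {φ : List A → M} (hφ : IsWordHom φ) (B : Set A)
    {u v : ι → List A} (h : ∀ n, ∀ᶠ i in U, XEquiv n (m + 1) (u i) (v i))
    (hu : ∀ᶠ i in U, ∀ a, a ∈ u i ↔ a ∈ B) :
    ∃ α β, IsTermPair U φ N (m + 1) B u v α β := by
  induction m generalizing M φ B u v with
  | zero =>
    have hv : ∀ᶠ i in U, ∀ a, a ∈ v i ↔ a ∈ B := by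
      filter_upwards [hu, h 1] with i hi h1 a
      rw [← h1.mem_iff, hi]
    obtain ⟨α, hα⟩ := exists_isLimitTerm hφ hN B hu
    obtain ⟨β, hβ⟩ := exists_isLimitTerm hφ hN B hv
    refine ⟨α, β, ⟨hα.1, hβ.1⟩, ⟨hα.2.1, hβ.2.1⟩, fun k => ?_⟩
    obtain ⟨i, h1, h2, h3⟩ := ((hα.2.2 k).and ((h k).and (hβ.2.2 k))).exists
    exact (h1.trans h2).trans h3.symm
  | succ m ihm =>
    induction B using WellFoundedLT.induction generalizing u v with
    | ind B ihB =>
    by_contra hcon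
    rcases B.eq_empty_or_nonempty with rfl | hB
    · have hnil : ∀ w : ι → List A, (∀ᶠ i in U, ∀ a, a ∈ w i ↔ a ∈ (∅ : Set A)) →
          ∀ᶠ i in U, [] = w i := fun w hw => by
        filter_upwards [hw] with i hi
        exact (List.eq_nil_iff_forall_not_mem.2 fun a ha => (hi a).1 ha).symm
      refine hcon ⟨_, _, IsTermPair.congr (u := fun _ => []) (v := fun _ => [])
        (by simpa using isTermPair_ofWord (m + 1 + 1) []) (hnil u hu) (hnil v ?_)⟩
      filter_upwards [hu, h 1] with i hi h1 a
      rw [← h1.mem_iff, hi]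
    let S := (ι → List A) × (ι → List A)
    let P : S → Prop := fun s =>
      ((∀ n, ∀ᶠ i in U, XEquiv n (m + 2) (s.1 i) (s.2 i)) ∧
        ∀ᶠ i in U, ∀ a, a ∈ s.1 i ↔ a ∈ B) ∧
      ¬ ∃ α β, IsTermPair U φ N (m + 2) B s.1 s.2 α β
    let R : S → M × M → S → Prop := fun s x t =>
      (∃ α β : PiTerm A, (HasAlph α B ∧ HasAlph β B) ∧
        (φ (α.substNat N), φ (β.substNat N)) = x ∧
        ∀ k, XEquiv k (m + 2) (α.substNat k) (β.substNat k)) ∧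
      ∀ᶠ i in U, φ (s.1 i) = x.1 * φ (t.1 i) ∧ φ (s.2 i) = x.2 * φ (t.2 i)
    have hR : ∀ s x t y r, R s x t → R t y r → R s (x * y) r := by
      rintro s _ t _ r ⟨⟨α, β, ⟨hα, hβ⟩, rfl, hαβ⟩, hst⟩ ⟨⟨α', β', ⟨hα', hβ'⟩, rfl, hαβ'⟩, htr⟩
      refine ⟨⟨.mul α α', .mul β β', ⟨?_, ?_⟩, ?_, fun k => (hαβ k).append (hαβ' k)⟩, ?_⟩
      · simpa using hα.mul hα'
      · simpa using hβ.mul hβ'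
      · simp [PiTerm.substNat, hφ.append]
      · filter_upwards [hst, htr] with i h1 h2
        simp [h1, h2, mul_assoc]
    have hstep : ∀ s, P s → ∃ x t, R s x t ∧ P t := by
      rintro s ⟨⟨hs, hsB⟩, hbad⟩
      obtain ⟨a, ha, C, hCB, hdec, hl, hr⟩ := exists_first_arch_family hB hsB
      have hmem : ∀ᶠ i in U, a ∈ s.1 i := hsB.mono fun i hi => (hi a).2 ha
      have hsl : ∀ n, ∀ᶠ i in U, XEquiv n (m + 2) (xl a (s.1 i)) (xl a (s.2 i)) := fun n => by
        filter_upwards [hs (n + 1), hmem] with i h1 h2 using h1.xl_right h2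
      have hsr : ∀ n, ∀ᶠ i in U, XEquiv n (m + 2) (xr a (s.1 i)) (xr a (s.2 i)) := fun n => by
        filter_upwards [hs (n + 1), hmem] with i h1 h2 using (h1.2.2 a h2).2
      have hdec' : ∀ᶠ i in U, xl a (s.2 i) ++ [a] ++ xr a (s.2 i) = s.2 i := by
        filter_upwards [hs 1, hmem] with i h1 h2
        simpa using xl_append_cons_xr ((h1.mem_iff a).1 h2)
      obtain ⟨α, β, hαβ⟩ := ihB _ (diff_singleton_lt ha) hsl hl
      have hαa := hαβ.mul hφ (isTermPair_ofWord (m + 2) [a])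
      rw [diff_union_singleton ha] at hαa
      have hno : ¬ ∃ γ δ, IsTermPair U φ N (m + 2) C (fun i => xr a (s.1 i))
          (fun i => xr a (s.2 i)) γ δ := by
        rintro ⟨γ, δ, hγδ⟩
        have := (hαa.mul hφ hγδ).congr hdec hdec'
        rw [Set.union_eq_left.2 hCB] at this
        exact hbad ⟨_, _, this⟩
      obtain rfl : C = B := by
        by_contra hne
        exact hno (ihB C (lt_of_le_of_ne hCB hne) hsr hr)
      refine ⟨_, (fun i => xr a (s.1 i), fun i => xr a (s.2 i)),
        ⟨⟨_, _, hαa.1, rfl, hαa.2.2⟩, ?_⟩, ⟨hsr, hr⟩, hno⟩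
      filter_upwards [hdec, hdec', hαa.2.1.1, hαa.2.1.2] with i h1 h2 h3 h4
      rw [← h3, ← h4, ← hφ.append, ← hφ.append, h1, h2]
      exact ⟨rfl, rfl⟩
    obtain ⟨s, e, t, hs, ht, ⟨⟨α, β, ⟨hα, hβ⟩, rfl, hαβ⟩, hst⟩, he⟩ :=
      exists_idempotent_step hR hstep (s := (u, v)) ⟨⟨h, hu⟩, hcon⟩
    have : Finite Mᵐᵒᵖ := Finite.of_equiv M MulOpposite.opEquiv
    obtain ⟨γ, δ, ⟨hγ, hδ⟩, ⟨hγu, hδv⟩, hγδ⟩ := ihm hφ.rev B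
      (u := fun i => (t.1 i).reverse) (v := fun i => (t.2 i).reverse)
      (fun n => (ht.1.1 (n + 1)).mono fun i hi => hi.2.1)
      (ht.1.2.mono fun i hi => by simpa using hi)
    simp only [List.reverse_reverse, MulOpposite.op_inj] at hγu hδv
    obtain ⟨he1, he2⟩ := Prod.ext_iff.1 he
    refine hs.2 ⟨.mul (.pi α) (revTerm γ), .mul (.pi β) (revTerm δ), ⟨?_, ?_⟩, ⟨?_, ?_⟩,
      fun k => ?_⟩
    · simpa using hα.pi.mul hγ.rev
    · simpa using hβ.pi.mul hδ.rev
    · filter_upwards [hst, hγu] with i h1 h2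
      simp only [PiTerm.substNat, substNat_revTerm, hφ.append, hφ.npow_of_idempotent he1 hN]
      rw [h1.1, h2]
    · filter_upwards [hst, hδv] with i h1 h2
      simp only [PiTerm.substNat, substNat_revTerm, hφ.append, hφ.npow_of_idempotent he2 hN]
      rw [h1.2, h2]
    · rcases Nat.eq_zero_or_pos k with rfl | hk
      · trivial
      simp only [PiTerm.substNat, substNat_revTerm]
      refine (XEquiv.npow_append le_rfl ?_ ?_ ?_).trans
        (((hαβ k).npow k).append (XEquiv.refl k (m + 2) (δ.substNat k).reverse))
      · exact fun a ha => (hα k hk a).2 ((hγ k hk a).1 (List.mem_reverse.1 ha))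
      · exact fun a ha => (hα k hk a).2 ((hδ k hk a).1 (List.mem_reverse.1 ha))
      · simpa using hγδ k

theorem one_le_monoidExp (M : Type) [Monoid M] [Finite M] : 1 ≤ monoidExp M := by
  refine (Nat.sInf_mem (s := {n : ℕ | 1 ≤ n ∧ ∀ x : M, IsIdempotentElem (x ^ n)}) ?_).1
  have h : ∀ x : M, ∃ d, 0 < d ∧ IsIdempotentElem (x ^ d) := by
    intro x
    obtain ⟨i, j, hij, hx⟩ := exists_idempotent_factor (fun i j => x ^ (j - i))
      fun i j k hij hjk => by rw [← pow_add]; congr 1; lia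
    exact ⟨j - i, by lia, hx⟩
  choose d hd hx using h
  cases nonempty_fintype M
  refine ⟨∏ x, d x, Finset.prod_pos fun x _ => hd x, fun x => ?_⟩
  obtain ⟨c, hc⟩ := Finset.dvd_prod_of_mem d (Finset.mem_univ x)
  rw [hc, pow_mul]
  exact (hx x).pow c

end WordFactor

open WordFactor in
/-- Lemma: from an infinite sequence of related word pairs one extracts π-terms. -/
theorem piTerm_construction (A : Type) [Fintype A] (M : Type) [Monoid M] [Finite M]
    (φ : FreeMonoid A →* M) (m : ℕ) (mu mv : M) (u v : ℕ → List A)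
    (h1 : ∀ n : ℕ, wEquiv ZKind.X m n (GWord.ofList (u n)) (GWord.ofList (v n)))
    (h2 : ∀ n : ℕ, φ (FreeMonoid.ofList (u n)) = mu)
    (h3 : ∀ n : ℕ, φ (FreeMonoid.ofList (v n)) = mv) :
    ∃ α β : PiTerm A,
      φ (FreeMonoid.ofList (α.substNat (monoidExp M))) = mu ∧
      φ (FreeMonoid.ofList (β.substNat (monoidExp M))) = mv ∧
      ∀ n : ℕ, wEquiv ZKind.X m n α.substOO β.substOO := by
  cases m with
  | zero =>
    refine ⟨ofWord (u 0), ofWord (v 0), by simp [h2], by simp [h3], fun n => ?_⟩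
    cases n <;> simp [wEquiv, eqvAux]
  | succ m =>
    let U : Ultrafilter ℕ := Filter.hyperfilter ℕ
    have hX : ∀ n, XEquiv n (m + 1) (u n) (v n) := fun n =>
      (Approx.eqvAux_iff (Approx.ofList (u n) n) (Approx.ofList (v n) n)).1.1 (h1 n)
    obtain ⟨B, hB⟩ := eventually_eq_const U fun i => {a | a ∈ u i}
    obtain ⟨α, β, -, ⟨hα, hβ⟩, hαβ⟩ := exists_isTermPair (U := U) (one_le_monoidExp M) m
      (φ := fun l => φ (FreeMonoid.ofList l)) ⟨by simp, fun u v => by simp⟩ B (u := u) (v := v)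
      (fun n => Nat.hyperfilter_le_atTop
        ((Filter.eventually_ge_atTop n).mono fun i hi => (hX i).mono hi))
      (hB.mono fun i hi a => Set.ext_iff.1 hi a)
    obtain ⟨i, hi⟩ := hα.exists
    obtain ⟨j, hj⟩ := hβ.exists
    exact ⟨α, β, hi.symm.trans (h2 i), hj.symm.trans (h3 j), fun n =>
      (Approx.eqvAux_iff (Approx.substOO α le_rfl) (Approx.substOO β le_rfl)).1.2 (hαβ n)⟩
end
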